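/- arXiv:1411.5871 — 4 statements merged into one kernel-verified Lean document; each statement's English description precedes it below -/
import Mathlib

section
/- Let F_2 : ℝ → ℝ be defined by F_2(x) = ∑_{n=1}^∞ (σ_1(n)/n^3)·sin(2πnx). Then F_2 is not differentiable at any rational point x ∈ ℚ. -/
open Real

noncomputable section

/-- The sum-of-divisors function `σ₁(n) = ∑_{d ∣ n} d`. -/
def sigma1 (n : ℕ) : ℕ := ∑ d ∈ n.divisors, d

/-- `F₂(x) = ∑_{n=1}^∞ σ₁(n)/n³ · sin(2πnx)`. -/
def F2 (x : ℝ) : ℝ :=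
  ∑' n : ℕ, (sigma1 (n + 1) : ℝ) / ((n : ℝ) + 1) ^ 3 * Real.sin (2 * π * ((n : ℝ) + 1) * x)

/-- The Fourier series `∑ sin(2πmy)/m³`. -/
def sinCubeSeries (y : ℝ) : ℝ := ∑' m : ℕ, 1 / (m : ℝ) ^ 3 * Real.sin (2 * π * m * y)

/-- The Fourier series `∑ cos(2πmy)/m²`. -/
def cosSquareSeries (y : ℝ) : ℝ := ∑' m : ℕ, 1 / (m : ℝ) ^ 2 * Real.cos (2 * π * m * y)

lemma norm_one_div_pow_mul_le {k : ℕ} (m : ℕ) {s : ℝ} (hs : |s| ≤ 1) :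
    ‖1 / (m : ℝ) ^ k * s‖ ≤ 1 / (m : ℝ) ^ k := by
  rw [norm_mul, Real.norm_of_nonneg (by positivity)]
  exact mul_le_of_le_one_right (by positivity) hs

lemma summable_cosSquareSeries (y : ℝ) :
    Summable fun m : ℕ => 1 / (m : ℝ) ^ 2 * Real.cos (2 * π * m * y) :=
  .of_norm_bounded (Real.summable_one_div_nat_pow.2 one_lt_two)
    fun m => norm_one_div_pow_mul_le m (abs_cos_le_one _)

lemma abs_sinCubeSeries_le (y : ℝ) : |sinCubeSeries y| ≤ ∑' m : ℕ, 1 / (m : ℝ) ^ 3 :=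
  tsum_of_norm_bounded (Real.summable_one_div_nat_pow.2 (by norm_num)).hasSum
    fun m => norm_one_div_pow_mul_le m (abs_sin_le_one _)

lemma hasDerivAt_sinCubeSeries (y : ℝ) :
    HasDerivAt sinCubeSeries (2 * π * cosSquareSeries y) y := by
  rw [cosSquareSeries, ← tsum_mul_left]
  refine hasDerivAt_tsum (g := fun (m : ℕ) z => 1 / (m : ℝ) ^ 3 * Real.sin (2 * π * m * z))
    (g' := fun m z => 2 * π * (1 / (m : ℝ) ^ 2 * Real.cos (2 * π * m * z)))
    (u := fun m : ℕ => 2 * π * (1 / (m : ℝ) ^ 2)) (y₀ := 0)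
    ((Real.summable_one_div_nat_pow.2 one_lt_two).mul_left _) (fun m z => ?_) (fun m z => ?_)
    ?_ y
  · have h := (((hasDerivAt_id z).const_mul (2 * π * m)).sin).const_mul (1 / (m : ℝ) ^ 3)
    refine h.congr_deriv ?_
    rcases eq_or_ne (m : ℝ) 0 with hm | hm
    · simp [hm]
    · simp only [id]
      field_simp
  · rw [norm_mul, Real.norm_of_nonneg (by positivity : 0 ≤ 2 * π)]
    gcongr
    exact norm_one_div_pow_mul_le m (abs_cos_le_one _)
  · simp

lemma cosSquareSeries_eq_fract (y : ℝ) :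
    cosSquareSeries y = π ^ 2 * (Int.fract y ^ 2 - Int.fract y + 1 / 6) := by
  have h := hasSum_one_div_nat_pow_mul_cos one_ne_zero (x := Int.fract y)
    ⟨Int.fract_nonneg y, (Int.fract_lt_one y).le⟩
  have hb : (Polynomial.map (algebraMap ℚ ℝ) (Polynomial.bernoulli (2 * 1))).eval (Int.fract y)
      = Int.fract y ^ 2 - Int.fract y + 1 / 6 := by
    rw [one_div]
    exact bernoulliFun_two _
  rw [hb] at h
  have hper (m : ℕ) : Real.cos (2 * π * m * Int.fract y) = Real.cos (2 * π * m * y) := by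
    rw [← Real.cos_sub_int_mul_two_pi (2 * π * m * y) (m * ⌊y⌋), Int.fract]
    congr 1
    push_cast
    ring
  simp only [hper] at h
  refine h.tsum_eq.trans ?_
  rw [show (Nat.factorial (2 * 1) : ℝ) = 2 by norm_num [Nat.factorial]]
  ring

lemma abs_fract_quadratic_sub_le {y z : ℝ} (h : y ≤ z) :
    |(Int.fract z ^ 2 - Int.fract z) - (Int.fract y ^ 2 - Int.fract y)| ≤ z - y := by
  have hy := Int.fract_nonneg y
  have hy' := Int.fract_lt_one y
  have hz := Int.fract_nonneg z
  have hz' := Int.fract_lt_one z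
  have ey := Int.floor_add_fract y
  have ez := Int.floor_add_fract z
  have hf : (⌊y⌋ : ℝ) ≤ ⌊z⌋ := by exact_mod_cast Int.floor_mono h
  set a := Int.fract y
  set b := Int.fract z
  rw [abs_le]
  rcases (Int.floor_mono h).eq_or_lt with e | e
  · have : z - y = b - a := by rw [← ey, ← ez, e]; ring
    rw [this]
    constructor <;> nlinarith
  · have : (⌊y⌋ : ℝ) + 1 ≤ ⌊z⌋ := by exact_mod_cast e
    have : b + (1 - a) ≤ z - y := by linarith
    constructor <;> nlinarith

lemma abs_cosSquareSeries_sub_le (y z : ℝ) :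
    |cosSquareSeries z - cosSquareSeries y| ≤ π ^ 2 * |z - y| := by
  wlog h : y ≤ z generalizing y z
  · rw [abs_sub_comm, abs_sub_comm z]
    exact this z y (le_of_not_ge h)
  rw [cosSquareSeries_eq_fract, cosSquareSeries_eq_fract, ← mul_sub, abs_mul,
    abs_of_nonneg (sq_nonneg π), abs_of_nonneg (sub_nonneg.2 h), add_sub_add_right_eq_sub]
  exact mul_le_mul_of_nonneg_left (abs_fract_quadratic_sub_le h) (sq_nonneg π)

lemma abs_sinCubeSeries_taylor_le (y : ℝ) {t : ℝ} (ht : 0 ≤ t) :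
    |sinCubeSeries (y + t) - sinCubeSeries y - 2 * π * cosSquareSeries y * t| ≤
      2 * π ^ 3 * t ^ 2 := by
  have hd : ∀ s ∈ Set.Icc 0 t, HasDerivWithinAt
      (fun s => sinCubeSeries (y + s) - 2 * π * cosSquareSeries y * s)
      (2 * π * cosSquareSeries (y + s) - 2 * π * cosSquareSeries y) (Set.Icc 0 t) s := by
    intro s _
    have h₁ := (hasDerivAt_sinCubeSeries (y + s)).comp_const_add y s
    have h₂ := (hasDerivAt_id s).const_mul (2 * π * cosSquareSeries y)
    exact ((h₁.sub h₂).congr_deriv (by simp)).hasDerivWithinAt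
  have hb : ∀ s ∈ Set.Icc 0 t,
      ‖2 * π * cosSquareSeries (y + s) - 2 * π * cosSquareSeries y‖ ≤ 2 * π ^ 3 * t := by
    intro s hs
    rw [← mul_sub, norm_mul, Real.norm_of_nonneg (by positivity : 0 ≤ 2 * π), Real.norm_eq_abs]
    have h := abs_cosSquareSeries_sub_le y (y + s)
    rw [add_sub_cancel_left, abs_of_nonneg hs.1] at h
    calc _ ≤ 2 * π * (π ^ 2 * t) := by
          gcongr
          exact h.trans (by gcongr; exact hs.2)
      _ = _ := by ring
  have := Convex.norm_image_sub_le_of_norm_hasDerivWithin_le hd hb (convex_Icc 0 t)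
    (Set.left_mem_Icc.2 ht) (Set.right_mem_Icc.2 ht)
  rw [Real.norm_eq_abs, sub_zero, Real.norm_of_nonneg ht] at this
  calc _ = |sinCubeSeries (y + t) - 2 * π * cosSquareSeries y * t -
        (sinCubeSeries (y + 0) - 2 * π * cosSquareSeries y * 0)| := by
          congr 1
          rw [add_zero]
          ring
    _ ≤ _ := this
    _ = _ := by ring

lemma F2_eq_tsum_sinCubeSeries (x : ℝ) :
    F2 x = ∑' d : ℕ, 1 / ((d : ℝ) + 1) ^ 2 * sinCubeSeries (((d : ℝ) + 1) * x) := by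
  let f : ℕ+ × ℕ+ → ℝ := fun p =>
    1 / (p.1 : ℝ) ^ 2 * (1 / (p.2 : ℝ) ^ 3 * Real.sin (2 * π * p.2 * (p.1 * x)))
  have hs {k : ℕ} (hk : 1 < k) : Summable fun d : ℕ+ => 1 / (d : ℝ) ^ k :=
    (Real.summable_one_div_nat_pow.2 hk).comp_injective PNat.coe_injective
  have hf : Summable f := by
    refine .of_norm_bounded ((hs one_lt_two).mul_of_nonneg (hs (k := 3) (by norm_num))
      (fun _ => by positivity) (fun _ => by positivity)) fun p => ?_
    rw [norm_mul, Real.norm_of_nonneg (by positivity : 0 ≤ 1 / (p.1 : ℝ) ^ 2)]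
    gcongr
    exact norm_one_div_pow_mul_le p.2 (abs_sin_le_one _)
  have hdiv (n : ℕ+) : (sigma1 n : ℝ) / (n : ℝ) ^ 3 * Real.sin (2 * π * n * x) =
      ∑' c : (n : ℕ).divisorsAntidiagonal, f (sigmaAntidiagonalEquivProd ⟨n, c⟩) := by
    rw [tsum_fintype, sigma1, ← Nat.sum_divisorsAntidiagonal (fun d _ => d), Nat.cast_sum,
      Finset.sum_div, Finset.sum_mul, ← Finset.sum_coe_sort]
    refine Finset.sum_congr rfl fun c _ => ?_
    obtain ⟨⟨a, b⟩, hc⟩ := c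
    have hab := (Nat.mem_divisorsAntidiagonal.1 hc).1
    have hn : ((n : ℕ) : ℝ) = a * b := by rw [← hab]; push_cast; rfl
    have ha : (a : ℝ) ≠ 0 := by rintro h; simp [h] at hn
    have hb : (b : ℝ) ≠ 0 := by rintro h; simp [h] at hn
    change _ = 1 / (a : ℝ) ^ 2 * (1 / (b : ℝ) ^ 3 * Real.sin (2 * π * b * (a * x)))
    rw [hn, show 2 * π * (a * b) * x = 2 * π * b * (a * x) by ring]
    field_simp
  have hsin (y : ℝ) : sinCubeSeries y =
      ∑' m : ℕ+, 1 / (m : ℝ) ^ 3 * Real.sin (2 * π * m * y) := by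
    rw [tsum_pnat_eq_tsum_succ (f := fun m : ℕ => 1 / (m : ℝ) ^ 3 * Real.sin (2 * π * m * y)),
      sinCubeSeries, Summable.tsum_eq_zero_add]
    · simp
    · exact .of_norm_bounded (Real.summable_one_div_nat_pow.2 (by norm_num))
        fun m => norm_one_div_pow_mul_le (k := 3) m (abs_sin_le_one _)
  calc F2 x = ∑' n : ℕ+, (sigma1 n : ℝ) / (n : ℝ) ^ 3 * Real.sin (2 * π * n * x) := by
        rw [tsum_pnat_eq_tsum_succ
          (f := fun n : ℕ => (sigma1 n : ℝ) / (n : ℝ) ^ 3 * Real.sin (2 * π * n * x)), F2]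
        simp
    _ = ∑' p : ℕ+ × ℕ+, f p := by
        rw [← sigmaAntidiagonalEquivProd.tsum_eq f,
          Summable.tsum_sigma (f := fun c => f (sigmaAntidiagonalEquivProd c))
            (sigmaAntidiagonalEquivProd.summable_iff.2 hf)]
        exact tsum_congr hdiv
    _ = ∑' d : ℕ+, 1 / (d : ℝ) ^ 2 * sinCubeSeries (d * x) := by
        rw [hf.tsum_prod]
        refine tsum_congr fun d => ?_
        rw [hsin, ← tsum_mul_left]
    _ = _ := by
        rw [tsum_pnat_eq_tsum_succ
          (f := fun d : ℕ => 1 / (d : ℝ) ^ 2 * sinCubeSeries (d * x))]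
        simp

lemma tsum_one_div_add_sq_le {N : ℕ} (hN : 0 < N) :
    ∑' k : ℕ, 1 / ((k : ℝ) + N + 1) ^ 2 ≤ 1 / (N : ℝ) := by
  have hN' : (0 : ℝ) < N := by exact_mod_cast hN
  refine Real.tsum_le_of_sum_range_le (fun _ => by positivity) fun M => ?_
  suffices ∑ k ∈ Finset.range M, 1 / ((k : ℝ) + N + 1) ^ 2 ≤ 1 / (N : ℝ) - 1 / (M + N) from
    this.trans (sub_le_self _ (by positivity))
  induction M with
  | zero => simp
  | succ M ih =>
    rw [Finset.sum_range_succ]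
    have : 1 / ((M : ℝ) + N + 1) ^ 2 ≤ 1 / (M + N) - 1 / (M + N + 1) := by
      rw [div_sub_div _ _ (by positivity) (by positivity), div_le_div_iff₀ (by positivity)
        (by positivity)]
      nlinarith [(Nat.cast_nonneg M : (0 : ℝ) ≤ M)]
    push_cast
    rw [add_right_comm (M : ℝ) 1 N]
    linarith

lemma exists_abs_F2_sub_le : ∃ C : ℝ, ∀ (x : ℝ) (N : ℕ), 0 < N →
    |F2 (x + 1 / N) - F2 x - 2 * π / N * ∑ d ∈ Finset.range N,
      cosSquareSeries (((d : ℝ) + 1) * x) / ((d : ℝ) + 1)| ≤ C / N := by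
  set B := ∑' m : ℕ, 1 / (m : ℝ) ^ 3
  have hB : 0 ≤ B := tsum_nonneg fun _ => by positivity
  refine ⟨2 * π ^ 3 + 2 * B, fun x N hN => ?_⟩
  have hN' : (0 : ℝ) < N := by exact_mod_cast hN
  have hsq : Summable fun d : ℕ => 1 / ((d : ℝ) + 1) ^ 2 := by
    simpa using (summable_nat_add_iff 1).2 (Real.summable_one_div_nat_pow.2 one_lt_two)
  have hφ (y : ℝ) : Summable fun d : ℕ =>
      1 / ((d : ℝ) + 1) ^ 2 * sinCubeSeries (((d : ℝ) + 1) * y) := by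
    refine .of_norm_bounded (hsq.mul_right B) fun d => ?_
    rw [norm_mul, Real.norm_of_nonneg (by positivity : 0 ≤ 1 / ((d : ℝ) + 1) ^ 2)]
    gcongr
    exact abs_sinCubeSeries_le _
  set g : ℕ → ℝ := fun d => 1 / ((d : ℝ) + 1) ^ 2 * sinCubeSeries (((d : ℝ) + 1) * (x + 1 / N)) -
    1 / ((d : ℝ) + 1) ^ 2 * sinCubeSeries (((d : ℝ) + 1) * x) with hg
  have hF : F2 (x + 1 / N) - F2 x = ∑ d ∈ Finset.range N, g d + ∑' d, g (d + N) := by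
    rw [((hφ _).sub (hφ _)).sum_add_tsum_nat_add N, (hφ _).tsum_sub (hφ _),
      F2_eq_tsum_sinCubeSeries, F2_eq_tsum_sinCubeSeries]
  have hhead : |∑ d ∈ Finset.range N, g d - 2 * π / N * ∑ d ∈ Finset.range N,
      cosSquareSeries (((d : ℝ) + 1) * x) / ((d : ℝ) + 1)| ≤ 2 * π ^ 3 / N := by
    rw [Finset.mul_sum, ← Finset.sum_sub_distrib]
    calc _ ≤ ∑ d ∈ Finset.range N, 2 * π ^ 3 / (N : ℝ) ^ 2 := by
          refine (Finset.abs_sum_le_sum_abs _ _).trans (Finset.sum_le_sum fun d _ => ?_)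
          have h := abs_sinCubeSeries_taylor_le (((d : ℝ) + 1) * x)
            (t := ((d : ℝ) + 1) / N) (by positivity)
          calc _ = 1 / ((d : ℝ) + 1) ^ 2 * |sinCubeSeries (((d : ℝ) + 1) * x + ((d : ℝ) + 1) / N) -
                sinCubeSeries (((d : ℝ) + 1) * x) -
                2 * π * cosSquareSeries (((d : ℝ) + 1) * x) * (((d : ℝ) + 1) / N)| := by
                have hw : 0 ≤ 1 / ((d : ℝ) + 1) ^ 2 := by positivity
                have hmul (s : ℝ) : 1 / ((d : ℝ) + 1) ^ 2 * |s| = |1 / ((d : ℝ) + 1) ^ 2 * s| := by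
                  rw [abs_mul, abs_of_nonneg hw]
                rw [hmul]
                congr 1
                simp only [hg]
                rw [mul_add, mul_one_div]
                field_simp
            _ ≤ 1 / ((d : ℝ) + 1) ^ 2 * (2 * π ^ 3 * (((d : ℝ) + 1) / N) ^ 2) := by gcongr
            _ = _ := by field_simp
      _ = _ := by
          rw [Finset.sum_const, Finset.card_range, nsmul_eq_mul]
          field_simp
  have htail : |∑' d, g (d + N)| ≤ 2 * B / N := by
    have hsN : Summable fun k : ℕ => 1 / ((k : ℝ) + N + 1) ^ 2 := by
      simpa using (summable_nat_add_iff N).2 hsq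
    refine (tsum_of_norm_bounded (f := fun d => g (d + N)) (hsN.mul_left (2 * B)).hasSum
      fun d => ?_).trans ?_
    · simp only [hg]
      rw [← mul_sub, norm_mul, Real.norm_of_nonneg (by positivity), mul_comm]
      push_cast
      gcongr
      refine (abs_sub _ _).trans ?_
      rw [two_mul]
      exact add_le_add (abs_sinCubeSeries_le _) (abs_sinCubeSeries_le _)
    · rw [tsum_mul_left, div_eq_mul_one_div (2 * B)]
      exact mul_le_mul_of_nonneg_left (tsum_one_div_add_sq_le hN) (by positivity)
  rw [hF, add_sub_right_comm, add_div]
  exact (abs_add_le _ _).trans (add_le_add hhead htail)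

lemma sum_cos_two_pi_mul_nonneg {q : ℕ} {t : ℝ} (ht : ∃ p : ℤ, q * t = p) :
    0 ≤ ∑ r ∈ Finset.range q, Real.cos (2 * π * (((r : ℝ) + 1) * t)) := by
  obtain ⟨p, hp⟩ := ht
  set z : ℂ := Complex.exp (2 * π * t * Complex.I) with hz
  have hzq : z ^ q = 1 := by
    rw [hz, ← Complex.exp_nat_mul, Complex.exp_eq_one_iff]
    refine ⟨p, ?_⟩
    have : (q : ℂ) * t = p := by exact_mod_cast hp
    linear_combination (2 * π * Complex.I) * this
  have hre (r : ℕ) : Real.cos (2 * π * (((r : ℝ) + 1) * t)) = (z * z ^ r).re := by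
    rw [← pow_succ', hz, ← Complex.exp_nat_mul, ← Complex.exp_ofReal_mul_I_re]
    congr 2
    push_cast
    ring
  simp_rw [hre]
  rw [← Complex.re_sum, ← Finset.mul_sum]
  rcases eq_or_ne z 1 with h | h
  · simp [h]
  · simp [geom_sum_eq h, hzq]

lemma sum_cosSquareSeries_pos {q : ℕ} (hq : 0 < q) {x : ℝ} (hx : ∃ p : ℤ, q * x = p) :
    0 < ∑ r ∈ Finset.range q, cosSquareSeries (((r : ℝ) + 1) * x) := by
  obtain ⟨p, hp⟩ := hx
  simp only [cosSquareSeries]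
  rw [← Summable.tsum_finsetSum fun r _ => summable_cosSquareSeries _]
  have hterm (m : ℕ) : ∑ r ∈ Finset.range q,
      1 / (m : ℝ) ^ 2 * Real.cos (2 * π * m * (((r : ℝ) + 1) * x)) = 1 / (m : ℝ) ^ 2 *
      ∑ r ∈ Finset.range q, Real.cos (2 * π * (((r : ℝ) + 1) * (m * x))) := by
    rw [Finset.mul_sum]
    refine Finset.sum_congr rfl fun r _ => ?_
    congr 2
    ring
  refine (summable_sum fun r _ => summable_cosSquareSeries _).tsum_pos (fun m => ?_) q ?_
  · rw [hterm]
    refine mul_nonneg (by positivity) (sum_cos_two_pi_mul_nonneg ⟨m * p, ?_⟩)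
    push_cast
    rw [← hp]
    ring
  · rw [hterm]
    refine mul_pos (by positivity) (Finset.sum_pos (fun r _ => ?_) ⟨0, by simpa using hq⟩)
    have : 2 * π * (((r : ℝ) + 1) * (q * x)) = (((r : ℤ) + 1) * p : ℤ) * (2 * π) := by
      rw [hp]
      push_cast
      ring
    rw [this, Real.cos_int_mul_two_pi]
    exact one_pos

lemma sum_range_mul_eq (f : ℕ → ℝ) (q M : ℕ) :
    ∑ d ∈ Finset.range (q * M), f d =
      ∑ k ∈ Finset.range M, ∑ r ∈ Finset.range q, f (q * k + r) := by
  induction M with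
  | zero => simp
  | succ M ih => rw [Nat.mul_succ, Finset.sum_range_add, ih, Finset.sum_range_succ]

/-- The harmonic-weighted partial sums of a periodic sequence with positive mean diverge. -/
lemma tendsto_sum_periodic_div_atTop {q : ℕ} (hq : 0 < q) {b : ℕ → ℝ} (hb : b.Periodic q)
    (hpos : 0 < ∑ r ∈ Finset.range q, b r) :
    Filter.Tendsto (fun M : ℕ => ∑ d ∈ Finset.range (q * M), b d / ((d : ℝ) + 1))
      Filter.atTop Filter.atTop := by
  set S := ∑ r ∈ Finset.range q, b r
  set A := ∑ r ∈ Finset.range q, |b r|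
  have hA : 0 ≤ A := Finset.sum_nonneg fun _ _ => abs_nonneg _
  have hq' : (1 : ℝ) ≤ q := by exact_mod_cast hq
  have hsq : Summable fun k : ℕ => 1 / ((k : ℝ) + 1) ^ 2 := by
    simpa using (summable_nat_add_iff 1).2 (Real.summable_one_div_nat_pow.2 one_lt_two)
  have hblock (k : ℕ) : S / q * (1 / ((k : ℝ) + 1)) - A * (1 / ((k : ℝ) + 1) ^ 2) ≤
      ∑ r ∈ Finset.range q, b (q * k + r) / (((q * k + r : ℕ) : ℝ) + 1) := by
    have hk : (0 : ℝ) ≤ k := Nat.cast_nonneg k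
    rw [div_mul_div_comm, mul_one, Finset.sum_div, Finset.sum_mul, ← Finset.sum_sub_distrib]
    refine Finset.sum_le_sum fun r hr => ?_
    have hbr : b (q * k + r) = b r := by
      rw [add_comm, mul_comm]
      simpa using hb.nat_mul k r
    rw [hbr, sub_le_comm]
    push_cast
    have hr' : (r : ℝ) + 1 ≤ q := by exact_mod_cast Finset.mem_range.1 hr
    have hr0 : (0 : ℝ) ≤ r := Nat.cast_nonneg r
    have hqk : (k : ℝ) ≤ q * k := by nlinarith
    have hδ : |1 / ((q : ℝ) * (k + 1)) - 1 / (q * k + r + 1)| ≤ 1 / ((k : ℝ) + 1) ^ 2 := by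
      rw [div_sub_div _ _ (by positivity) (by positivity), abs_div,
        abs_of_pos (by positivity : 0 < (q : ℝ) * (k + 1) * (q * k + r + 1)),
        div_le_div_iff₀ (by positivity) (by positivity)]
      have h₁ : |1 * ((q : ℝ) * k + r + 1) - q * (k + 1) * 1| ≤ q := by
        rw [abs_le]
        constructor <;> linarith
      have h₂ : ((k : ℝ) + 1) ≤ q * k + r + 1 := by linarith
      calc _ ≤ (q : ℝ) * ((k + 1) * (k + 1)) := by rw [← sq]; gcongr
        _ ≤ (q : ℝ) * ((k + 1) * (q * k + r + 1)) := by gcongr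
        _ = _ := by ring
    calc _ = b r * (1 / ((q : ℝ) * (k + 1)) - 1 / (q * k + r + 1)) := by ring
      _ ≤ |b r * (1 / ((q : ℝ) * (k + 1)) - 1 / (q * k + r + 1))| := le_abs_self _
      _ ≤ _ := by
        rw [abs_mul]
        gcongr
  refine Filter.tendsto_atTop_mono (fun M => ?_) (Filter.tendsto_atTop_add_const_right _
    (-(A * ∑' k : ℕ, 1 / ((k : ℝ) + 1) ^ 2))
    (Real.tendsto_sum_range_one_div_nat_succ_atTop.const_mul_atTop
      (div_pos hpos (by positivity : (0 : ℝ) < q))))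
  rw [sum_range_mul_eq]
  have h₁ := Finset.sum_le_sum fun k (_ : k ∈ Finset.range M) => hblock k
  rw [Finset.sum_sub_distrib, ← Finset.mul_sum, ← Finset.mul_sum] at h₁
  have h₂ : A * ∑ k ∈ Finset.range M, 1 / ((k : ℝ) + 1) ^ 2 ≤
      A * ∑' k : ℕ, 1 / ((k : ℝ) + 1) ^ 2 :=
    mul_le_mul_of_nonneg_left (hsq.sum_le_tsum _ fun _ _ => by positivity) hA
  linarith

/-- `F₂` is not differentiable at any rational point. -/
theorem F2_not_differentiableAt_rat (x : ℚ) :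
    ¬ DifferentiableAt ℝ F2 (x : ℝ) := by
  intro hdiff
  obtain ⟨C, hC⟩ := exists_abs_F2_sub_le
  have hx : (x.den : ℝ) * x = x.num := by exact_mod_cast Rat.den_mul_eq_num x
  have hper : Function.Periodic (fun d : ℕ => cosSquareSeries (((d : ℝ) + 1) * x)) x.den := by
    intro d
    simp only [cosSquareSeries_eq_fract]
    have : (((d + x.den : ℕ) : ℝ) + 1) * x = ((d : ℝ) + 1) * x + x.num := by
      rw [← hx]
      push_cast
      ring
    rw [this, Int.fract_add_intCast]
  obtain ⟨L, hL⟩ := hdiff.isBigO_sub.bound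
  have hseq : Filter.Tendsto (fun N : ℕ => (x : ℝ) + 1 / N) Filter.atTop (nhds x) := by
    simpa using tendsto_one_div_atTop_nhds_zero_nat.const_add (x : ℝ)
  have hmul : Filter.Tendsto (fun M : ℕ => x.den * M) Filter.atTop Filter.atTop :=
    Filter.tendsto_id.const_mul_atTop' x.den_pos
  obtain ⟨M, ⟨hM, hL⟩, hpos⟩ :=
    (((tendsto_sum_periodic_div_atTop x.den_pos hper
      (sum_cosSquareSeries_pos x.den_pos ⟨x.num, hx⟩)).eventually_gt_atTop
        ((L + C) / (2 * π))).and ((hseq.comp hmul).eventually hL) |>.and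
          (hmul.eventually_gt_atTop 0)).exists
  have h := (abs_le.1 (hC x _ hpos)).1
  simp only [Function.comp_apply, add_sub_cancel_left] at hL
  generalize x.den * M = N at hM hL hpos h
  have hN : (0 : ℝ) < N := by exact_mod_cast hpos
  rw [Real.norm_of_nonneg (by positivity : (0 : ℝ) ≤ 1 / N)] at hL
  have hL' := (le_abs_self _).trans hL
  rw [div_lt_iff₀ (by positivity)] at hM
  set T := ∑ d ∈ Finset.range N, cosSquareSeries (((d : ℝ) + 1) * x) / ((d : ℝ) + 1)
  have hlt : (L + C) / N < T * (2 * π) / N := by gcongr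
  have e₁ : 2 * π / N * T = T * (2 * π) / N := by ring
  have e₂ : (L + C) / N = L * (1 / N) + C / N := by ring
  linarith

end
end

section
/- Let G_2 : ℝ → ℝ be defined by G_2(x) = ∑_{n=1}^∞ (σ_1(n)/n^3)·cos(2πnx). Then at every rational point p/q (written in lowest terms with q ≥ 1; for x = 0 take p = 0, q = 1), G_2 has a finite right derivative G_2'((p/q)^+) and a finite left derivative G_2'((p/q)^-), G_2 is not differentiable at p/q, and G_2'((p/q)^-) − G_2'((p/q)^+) = π^4/(3q^2). -/
open Real

noncomputable section

/-- `G₂(x) = ∑_{n=1}^∞ σ₁(n)/n³ · cos(2πnx)`. -/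
def G2 (x : ℝ) : ℝ :=
  ∑' n : ℕ, (sigma1 (n + 1) : ℝ) / ((n : ℝ) + 1) ^ 3 * Real.cos (2 * π * ((n : ℝ) + 1) * x)

open Filter Topology

/-- The `1`-periodic function agreeing with `π² B₂` on `[0, 1]`. -/
def periodicBernoulliTwo (y : ℝ) : ℝ := π ^ 2 * (Int.fract y ^ 2 - Int.fract y + 6⁻¹)

theorem hasSum_cos_div_sq (y : ℝ) :
    HasSum (fun n : ℕ ↦ 1 / (n : ℝ) ^ 2 * Real.cos (2 * π * n * y)) (periodicBernoulliTwo y) := by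
  have h := hasSum_one_div_nat_pow_mul_cos (k := 1) one_ne_zero
    (x := Int.fract y) ⟨Int.fract_nonneg y, (Int.fract_lt_one y).le⟩
  have hb := bernoulliFun_two (Int.fract y)
  rw [bernoulliFun] at hb
  simp only [mul_one] at h
  rw [hb] at h
  convert! h using 1
  · ext n
    have : 2 * π * n * y = 2 * π * n * Int.fract y + ((n * ⌊y⌋ : ℤ) : ℝ) * (2 * π) := by
      push_cast
      rw [Int.fract]
      ring
    rw [this, Real.cos_add_int_mul_two_pi]
  · rw [periodicBernoulliTwo, Nat.factorial_two]
    push_cast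
    ring

theorem abs_periodicBernoulliTwo_le (y : ℝ) : |periodicBernoulliTwo y| ≤ π ^ 2 := by
  have h0 := Int.fract_nonneg y
  have h1 := Int.fract_lt_one y
  rw [periodicBernoulliTwo, abs_mul, abs_of_nonneg (sq_nonneg π)]
  refine mul_le_of_le_one_right (sq_nonneg π) (abs_le.2 ⟨?_, ?_⟩) <;> nlinarith

theorem abs_periodicBernoulliTwo_sub_le_of_le {x y : ℝ} (hxy : x ≤ y) :
    |periodicBernoulliTwo y - periodicBernoulliTwo x| ≤ π ^ 2 * (y - x) := by
  have hx0 := Int.fract_nonneg x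
  have hx1 := Int.fract_lt_one x
  have hy0 := Int.fract_nonneg y
  have hy1 := Int.fract_lt_one y
  have hx := Int.floor_add_fract x
  have hy := Int.floor_add_fract y
  rw [periodicBernoulliTwo, periodicBernoulliTwo, ← mul_sub, abs_mul,
    abs_of_nonneg (sq_nonneg π)]
  refine mul_le_mul_of_nonneg_left ?_ (sq_nonneg π)
  have hle : ⌊x⌋ ≤ ⌊y⌋ := Int.floor_mono hxy
  generalize Int.fract x = s at *
  generalize Int.fract y = t at *
  generalize ⌊x⌋ = a at *
  generalize ⌊y⌋ = b at *
  rcases hle.eq_or_lt with rfl | hlt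
  · rw [abs_le]
    constructor <;> nlinarith
  · have : (a : ℝ) + 1 ≤ b := by exact_mod_cast hlt
    rw [abs_le]
    constructor <;> nlinarith

theorem abs_periodicBernoulliTwo_sub_le (x y : ℝ) :
    |periodicBernoulliTwo y - periodicBernoulliTwo x| ≤ π ^ 2 * |y - x| := by
  rcases le_total x y with h | h
  · rw [abs_of_nonneg (sub_nonneg.2 h)]
    exact abs_periodicBernoulliTwo_sub_le_of_le h
  · rw [abs_sub_comm, abs_sub_comm y, abs_of_nonneg (sub_nonneg.2 h)]
    exact abs_periodicBernoulliTwo_sub_le_of_le h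

theorem hasDerivWithinAt_periodicBernoulliTwo (y : ℝ) :
    HasDerivWithinAt periodicBernoulliTwo (π ^ 2 * (2 * Int.fract y - 1)) (Set.Ici y) y := by
  have h : HasDerivAt (fun z : ℝ ↦ π ^ 2 * ((z - ⌊y⌋) ^ 2 - (z - ⌊y⌋) + 6⁻¹))
      (π ^ 2 * (2 * Int.fract y - 1)) y := by
    have h1 : HasDerivAt (fun z : ℝ ↦ z - ⌊y⌋) 1 y := (hasDerivAt_id y).sub_const _
    convert! (((h1.pow 2).sub h1).add_const (6⁻¹ : ℝ)).const_mul (π ^ 2) using 1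
    rw [Int.fract]
    simp
  refine h.hasDerivWithinAt.congr_of_eventuallyEq ?_ rfl
  filter_upwards [Ico_mem_nhdsGE (Int.lt_floor_add_one y)] with z hz
  have : ⌊z⌋ = ⌊y⌋ := Int.floor_eq_iff.2 ⟨(Int.floor_le y).trans hz.1, hz.2⟩
  rw [periodicBernoulliTwo, Int.fract, this]

theorem G2_eq_tsum (x : ℝ) :
    G2 x = ∑' m : ℕ, 1 / (m : ℝ) ^ 3 * periodicBernoulliTwo (m * x) := by
  let F : ℕ → ℕ → ℝ := fun a b ↦
    1 / (a : ℝ) ^ 2 * (1 / (b : ℝ) ^ 3) * Real.cos (2 * π * (a * b) * x)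
  have hs : Summable fun c : ℕ+ × ℕ+ ↦ F c.1 c.2 := by
    have h2 : Summable fun a : ℕ+ ↦ 1 / (a : ℝ) ^ 2 :=
      summable_pnat_iff_summable_nat.2 (Real.summable_one_div_nat_pow.2 (by norm_num))
    have h3 : Summable fun a : ℕ+ ↦ 1 / (a : ℝ) ^ 3 :=
      summable_pnat_iff_summable_nat.2 (Real.summable_one_div_nat_pow.2 (by norm_num))
    refine Summable.of_norm_bounded
      (h2.mul_of_nonneg h3 (fun _ ↦ by positivity) (fun _ ↦ by positivity)) fun c ↦ ?_
    simp only [F, norm_mul]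
    rw [Real.norm_of_nonneg (by positivity), Real.norm_of_nonneg (by positivity)]
    exact mul_le_of_le_one_right (by positivity) (Real.abs_cos_le_one _)
  have hL : G2 x = ∑' c : ℕ+ × ℕ+, F c.1 c.2 := by
    have hs' := sigmaAntidiagonalEquivProd.summable_iff.2 hs
    refine .trans ?_ (hs'.tsum_sigma.symm.trans
      (sigmaAntidiagonalEquivProd.tsum_eq fun c : ℕ+ × ℕ+ ↦ F c.1 c.2))
    rw [G2]
    have := tsum_pnat_eq_tsum_succ
      (f := fun n : ℕ ↦ (sigma1 n : ℝ) / (n : ℝ) ^ 3 * Real.cos (2 * π * n * x))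
    push_cast at this
    rw [← this]
    refine tsum_congr fun n ↦ ?_
    rw [tsum_fintype]
    change _ = ∑ b ∈ (n : ℕ).divisorsAntidiagonal.attach, F b.1.1 b.1.2
    rw [(n : ℕ).divisorsAntidiagonal.sum_attach fun b ↦ F b.1 b.2,
      Nat.sum_divisorsAntidiagonal F, sigma1, Nat.cast_sum, Finset.sum_div, Finset.sum_mul]
    refine Finset.sum_congr rfl fun d hd ↦ ?_
    obtain ⟨k, hk⟩ := Nat.dvd_of_mem_divisors hd
    have hd0 : 0 < d := Nat.pos_of_mem_divisors hd
    have hk0 : 0 < k := Nat.pos_of_ne_zero fun h ↦ by simp [h] at hk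
    simp only [F]
    rw [hk, Nat.mul_div_cancel_left k hd0, Nat.cast_mul]
    field_simp
  have hF (b : ℕ) :
      HasSum (fun a : ℕ+ ↦ F a b) (1 / (b : ℝ) ^ 3 * periodicBernoulliTwo (b * x)) := by
    refine hasSum_pnat_iff (f := fun a ↦ F a b) |>.2 ?_
    convert! (hasSum_cos_div_sq (b * x)).mul_left (1 / (b : ℝ) ^ 3) using 1
    · ext a
      simp only [F]
      rw [show 2 * π * (a * b) * x = 2 * π * a * (b * x) by ring]
      ring
    · simp [F]
  rw [hL, hs.tsum_prod, Summable.tsum_comm (f := fun b a : ℕ+ ↦ F a b) hs.prod_symm,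
    ← tsum_pnat_eq_tsum_of_eq_zero (by simp)]
  exact tsum_congr fun b ↦ (hF b).tsum_eq

theorem summable_periodicBernoulliTwo (x : ℝ) :
    Summable fun m : ℕ ↦ 1 / (m : ℝ) ^ 3 * periodicBernoulliTwo (m * x) := by
  refine Summable.of_norm_bounded ((Real.summable_one_div_nat_pow.2
    (by norm_num : 1 < 3)).mul_right (π ^ 2)) fun m ↦ ?_
  rw [norm_mul, Real.norm_of_nonneg (by positivity)]
  exact mul_le_mul_of_nonneg_left (abs_periodicBernoulliTwo_le _) (by positivity)

/-- The right derivative of `G2`. -/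
def G2RightDeriv (x : ℝ) : ℝ := ∑' m : ℕ, 1 / (m : ℝ) ^ 2 * (π ^ 2 * (2 * Int.fract (m * x) - 1))

theorem summable_G2RightDeriv (x : ℝ) :
    Summable fun m : ℕ ↦ 1 / (m : ℝ) ^ 2 * (π ^ 2 * (2 * Int.fract (m * x) - 1)) := by
  refine Summable.of_norm_bounded ((Real.summable_one_div_nat_pow.2
    (by norm_num : 1 < 2)).mul_right (π ^ 2)) fun m ↦ ?_
  rw [norm_mul, Real.norm_of_nonneg (by positivity), norm_mul, Real.norm_of_nonneg (sq_nonneg π)]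
  have h0 := Int.fract_nonneg (m * x)
  have h1 := Int.fract_lt_one (m * x)
  refine mul_le_mul_of_nonneg_left (mul_le_of_le_one_right (sq_nonneg π) ?_) (by positivity)
  rw [Real.norm_eq_abs, abs_le]
  constructor <;> linarith

theorem hasDerivWithinAt_G2_Ici (x : ℝ) :
    HasDerivWithinAt G2 (G2RightDeriv x) (Set.Ici x) x := by
  rw [hasDerivWithinAt_iff_tendsto_slope]
  have hslope : slope G2 x = fun y ↦
      ∑' m : ℕ, slope (fun z ↦ 1 / (m : ℝ) ^ 3 * periodicBernoulliTwo (m * z)) x y := by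
    ext y
    simp only [slope_def_field]
    rw [tsum_div_const, (summable_periodicBernoulliTwo y).tsum_sub
      (summable_periodicBernoulliTwo x), ← G2_eq_tsum, ← G2_eq_tsum]
  rw [hslope]
  refine tendsto_tsum_of_dominated_convergence (bound := fun m : ℕ ↦ 1 / (m : ℝ) ^ 2 * π ^ 2)
    ((Real.summable_one_div_nat_pow.2 (by norm_num)).mul_right _) (fun m ↦ ?_)
    (Eventually.of_forall fun y m ↦ ?_)
  · rw [← hasDerivWithinAt_iff_tendsto_slope]
    rcases Nat.eq_zero_or_pos m with rfl | hm
    · simpa using hasDerivWithinAt_const x (Set.Ici x) (0 : ℝ)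
    have hm' : (0 : ℝ) < m := by exact_mod_cast hm
    have h1 : HasDerivWithinAt (fun z : ℝ ↦ m * z) m (Set.Ici x) x := by
      simpa using ((hasDerivAt_id x).const_mul (m : ℝ)).hasDerivWithinAt
    have h2 := ((hasDerivWithinAt_periodicBernoulliTwo (m * x)).comp x h1
      fun z hz ↦ mul_le_mul_of_nonneg_left hz hm'.le).const_mul (1 / (m : ℝ) ^ 3)
    convert! h2 using 1
    field_simp
  · rcases Nat.eq_zero_or_pos m with rfl | hm
    · simp [slope_def_field]
    have hm' : (0 : ℝ) < m := by exact_mod_cast hm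
    rw [slope_def_field, ← mul_sub, norm_div, norm_mul, Real.norm_of_nonneg (by positivity)]
    refine div_le_of_le_mul₀ (norm_nonneg _) (by positivity) ?_
    have h := abs_periodicBernoulliTwo_sub_le (m * x) (m * y)
    rw [← mul_sub, abs_mul, abs_of_pos hm'] at h
    calc _ ≤ 1 / (m : ℝ) ^ 3 * (π ^ 2 * (m * |y - x|)) :=
          mul_le_mul_of_nonneg_left h (by positivity)
      _ = _ := by
        rw [Real.norm_eq_abs]
        field_simp

theorem G2_neg (x : ℝ) : G2 (-x) = G2 x := by
  simp [G2]

theorem hasDerivWithinAt_G2_Iic (x : ℝ) :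
    HasDerivWithinAt G2 (-G2RightDeriv (-x)) (Set.Iic x) x := by
  have h := (hasDerivWithinAt_G2_Ici (-x)).comp x (hasDerivAt_neg x).hasDerivWithinAt
    (s := Set.Iic x) fun z (hz : z ≤ x) ↦ neg_le_neg hz
  convert! h using 1
  · ext z
    exact (G2_neg z).symm
  · ring

theorem G2_derivative_jump {p : ℤ} {q : ℕ} (hq : 0 < q) (hpq : Int.gcd p (q : ℤ) = 1) :
    -G2RightDeriv (-((p : ℝ) / q)) - G2RightDeriv ((p : ℝ) / q) = π ^ 4 / (3 * (q : ℝ) ^ 2) := by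
  have hq' : (q : ℝ) ≠ 0 := by exact_mod_cast hq.ne'
  set x : ℝ := (p : ℝ) / q
  have hterm (m : ℕ) : -(1 / (m : ℝ) ^ 2 * (π ^ 2 * (2 * Int.fract (m * -x) - 1))) -
      1 / (m : ℝ) ^ 2 * (π ^ 2 * (2 * Int.fract (m * x) - 1)) =
      if q ∣ m then 2 * π ^ 2 * (1 / (m : ℝ) ^ 2) else 0 := by
    have hdvd : Int.fract (m * x) = 0 ↔ q ∣ m := by
      rw [Int.fract_eq_zero_iff, ← Int.natCast_dvd_natCast]
      constructor
      · rintro ⟨z, hz⟩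
        refine (Int.isCoprime_iff_gcd_eq_one.2 hpq).symm.dvd_of_dvd_mul_right ⟨z, ?_⟩
        simp only [x] at hz
        field_simp at hz
        have hz' : z * (q : ℤ) = m * p := by exact_mod_cast hz
        linarith
      · rintro ⟨z, hz⟩
        refine ⟨z * p, ?_⟩
        have hz' : (m : ℝ) = q * z := by exact_mod_cast hz
        simp only [x]
        rw [hz']
        push_cast
        field_simp
    rw [mul_neg]
    split_ifs with h
    · rw [hdvd.2 h, Int.fract_neg_eq_zero.2 (hdvd.2 h)]
      ring
    · rw [Int.fract_neg (mt hdvd.1 h)]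
      ring
  have hsum : HasSum (fun m : ℕ ↦ if q ∣ m then 2 * π ^ 2 * (1 / (m : ℝ) ^ 2) else 0)
      (π ^ 4 / (3 * (q : ℝ) ^ 2)) := by
    refine (Function.Injective.hasSum_iff (mul_right_injective₀ hq.ne') fun m hm ↦
      if_neg fun ⟨k, hk⟩ ↦ hm ⟨k, hk.symm⟩).1 ?_
    convert! hasSum_zeta_two.mul_left (2 * π ^ 2 / (q : ℝ) ^ 2) using 1
    · ext k
      simp only [Function.comp_apply, dvd_mul_right, if_true]
      push_cast
      ring
    · ring
  rw [G2RightDeriv, G2RightDeriv, ← tsum_neg, ← (summable_G2RightDeriv (-x)).neg.tsum_sub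
    (summable_G2RightDeriv x), ← hsum.tsum_eq]
  exact tsum_congr hterm

/-- At every rational `p/q` in lowest terms (`q ≥ 1`), `G₂` has a finite right derivative `R`
and a finite left derivative `L`, is not differentiable, and `L - R = π⁴/(3q²)`. -/
theorem G2_one_sided_derivatives_at_rat (p : ℤ) (q : ℕ) (hq : 0 < q)
    (hpq : Int.gcd p (q : ℤ) = 1) :
    ∃ R L : ℝ,
      HasDerivWithinAt G2 R (Set.Ici ((p : ℝ) / (q : ℝ))) ((p : ℝ) / (q : ℝ)) ∧
      HasDerivWithinAt G2 L (Set.Iic ((p : ℝ) / (q : ℝ))) ((p : ℝ) / (q : ℝ)) ∧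
      ¬ DifferentiableAt ℝ G2 ((p : ℝ) / (q : ℝ)) ∧
      L - R = π ^ 4 / (3 * (q : ℝ) ^ 2) := by
  have hR := hasDerivWithinAt_G2_Ici ((p : ℝ) / q)
  have hL := hasDerivWithinAt_G2_Iic ((p : ℝ) / q)
  have hjump := G2_derivative_jump hq hpq
  refine ⟨_, _, hR, hL, fun hd ↦ ?_, hjump⟩
  have h1 := (uniqueDiffWithinAt_Ici _).eq_deriv _ hR hd.hasDerivAt.hasDerivWithinAt
  have h2 := (uniqueDiffWithinAt_Iic _).eq_deriv _ hL hd.hasDerivAt.hasDerivWithinAt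
  rw [h1, h2, sub_self] at hjump
  have : (0 : ℝ) < π ^ 4 / (3 * (q : ℝ) ^ 2) := by positivity
  exact this.ne hjump

end
end

section
/- Let x ∈ (0,1) be irrational. If x is a square-Brjuno number and x satisfies Condition (*) or Condition (**), then F_2 is differentiable at x, where F_2(x) = ∑_{n=1}^∞ (σ_1(n)/n^3)·sin(2πnx). -/
open Real Filter

noncomputable section

/-- The Gauss map: `T 0 = 0` and `T y = 1/y mod 1` otherwise. -/
def gauss (y : ℝ) : ℝ := if y = 0 then 0 else Int.fract y⁻¹

/-- The denominators `q_n(x)` of the continued fraction convergents of `x`: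
`q_0 = 1`, `q_1 = a_1 = ⌊1/x⌋`, and `q_{n+2} = a_{n+2} q_{n+1} + q_n`
where `a_i(x) = ⌊1/T^{i-1}(x)⌋`. -/
def qden (x : ℝ) : ℕ → ℤ
  | 0 => 1
  | 1 => ⌊x⁻¹⌋
  | n + 2 => ⌊(gauss^[n + 1] x)⁻¹⌋ * qden x (n + 1) + qden x n

/-- `x` is a square-Brjuno number: `∑_{n=0}^∞ log(q_{n+1}(x))/q_n(x)² < ∞`. -/
def SquareBrjuno (x : ℝ) : Prop :=
  Summable fun n : ℕ => Real.log ((qden x (n + 1) : ℝ)) / (qden x n : ℝ) ^ 2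

/-- Condition (*): `log(q_{n+4}(x))/q_n(x)² → 0`. -/
def CondStar (x : ℝ) : Prop :=
  Tendsto (fun n : ℕ => Real.log ((qden x (n + 4) : ℝ)) / (qden x n : ℝ) ^ 2) atTop (nhds 0)

/-- Condition (**): `log(q_{n+3}(x))/q_n(x)² → 0` and `a_n(x) = 1` for only finitely many `n`. -/
def CondStarStar (x : ℝ) : Prop :=
  Tendsto (fun n : ℕ => Real.log ((qden x (n + 3) : ℝ)) / (qden x n : ℝ) ^ 2) atTop (nhds 0) ∧
  {n : ℕ | ⌊(gauss^[n] x)⁻¹⌋ = (1 : ℤ)}.Finite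

/-- The Clausen function `∑ r ^ n * sin (2πny) / n²` with an Abel summation factor. -/
def clausen (r y : ℝ) : ℝ := ∑' n : ℕ, r ^ n * (Real.sin (2 * π * n * y) / (n : ℝ) ^ 2)

lemma norm_clausen_term_le {r : ℝ} (hr₀ : 0 ≤ r) (hr₁ : r ≤ 1) (n : ℕ) (y : ℝ) :
    ‖r ^ n * (Real.sin (2 * π * n * y) / (n : ℝ) ^ 2)‖ ≤ ((n : ℝ) ^ 2)⁻¹ := by
  rw [norm_mul, norm_div, norm_pow, norm_pow, Real.norm_of_nonneg hr₀, Real.norm_natCast,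
    div_eq_mul_inv, ← mul_assoc]
  refine mul_le_of_le_one_left (by positivity) ?_
  exact mul_le_one₀ (pow_le_one₀ hr₀ hr₁) (norm_nonneg _) (Real.abs_sin_le_one _)

lemma summable_inv_nat_sq : Summable fun n : ℕ => ((n : ℝ) ^ 2)⁻¹ :=
  Real.summable_nat_pow_inv.2 one_lt_two

lemma continuous_clausen_one : Continuous (clausen 1) :=
  continuous_tsum (fun n => by fun_prop) summable_inv_nat_sq
    (fun n y => norm_clausen_term_le zero_le_one le_rfl n y)

lemma tendsto_clausen (y : ℝ) :
    Tendsto (fun r => clausen r y) (nhdsWithin 1 (Set.Iio 1)) (nhds (clausen 1 y)) := by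
  refine tendsto_tsum_of_dominated_convergence summable_inv_nat_sq (fun n => ?_) ?_
  · refine Tendsto.mono_left (Continuous.tendsto ?_ _) nhdsWithin_le_nhds
    fun_prop
  · filter_upwards [Ioo_mem_nhdsLT (zero_lt_one' ℝ)] with r hr n
    exact norm_clausen_term_le hr.1.le hr.2.le n y

lemma hasDerivAt_clausen_of_lt_one {r : ℝ} (hr₀ : 0 ≤ r) (hr₁ : r < 1) (y : ℝ) :
    HasDerivAt (clausen r)
      (-(2 * π * Real.log ‖1 - r * Complex.exp (Complex.I * (2 * π * y : ℝ))‖)) y := by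
  have hterm (n : ℕ) (y : ℝ) :
      HasDerivAt (fun y => r ^ n * (Real.sin (2 * π * n * y) / (n : ℝ) ^ 2))
        (2 * π * (r ^ n * Real.cos (2 * π * n * y) / n)) y := by
    have h : HasDerivAt (fun y => r ^ n * (Real.sin (2 * π * n * y) / (n : ℝ) ^ 2))
        (r ^ n * (Real.cos (2 * π * n * y) * (2 * π * n * 1) / (n : ℝ) ^ 2)) y :=
      ((((hasDerivAt_id y).const_mul (2 * π * n)).sin).div_const _).const_mul _
    convert h using 1
    rcases eq_or_ne n 0 with rfl | hn
    · simp
    · field_simp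
  have hsum := hasDerivAt_tsum ((summable_geometric_of_lt_one hr₀ hr₁).mul_left (2 * π)) hterm
    (fun n y => by
      rw [norm_mul (2 * π), norm_div, norm_mul (r ^ n), norm_pow, Real.norm_natCast,
        Real.norm_of_nonneg hr₀, Real.norm_of_nonneg two_pi_pos.le]
      refine mul_le_mul_of_nonneg_left ?_ two_pi_pos.le
      rcases eq_or_ne n 0 with rfl | hn
      · simp
      · refine (div_le_self (by positivity) ?_).trans ?_
        · exact_mod_cast Nat.one_le_iff_ne_zero.2 hn
        · exact mul_le_of_le_one_right (by positivity) (Real.abs_cos_le_one _))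
    (y₀ := 0) (by simp) y
  have hz : ‖(r * Complex.exp (Complex.I * (2 * π * y : ℝ)) : ℂ)‖ < 1 := by
    rw [norm_mul, Complex.norm_exp_I_mul_ofReal, mul_one, Complex.norm_real,
      Real.norm_of_nonneg hr₀]
    exact hr₁
  have hlog := (Complex.hasSum_re (Complex.hasSum_taylorSeries_neg_log hz)).mul_left (2 * π)
  have hval : (2 * π) * (-Complex.log (1 - r * Complex.exp (Complex.I * (2 * π * y : ℝ)))).re =
      -(2 * π * Real.log ‖1 - r * Complex.exp (Complex.I * (2 * π * y : ℝ))‖) := by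
    rw [Complex.neg_re, Complex.log_re]; ring
  have hseries : HasSum (fun n : ℕ => 2 * π * (r ^ n * Real.cos (2 * π * n * y) / n))
      (-(2 * π * Real.log ‖1 - r * Complex.exp (Complex.I * (2 * π * y : ℝ))‖)) := by
    rw [← hval]
    refine hlog.congr_fun fun n => ?_
    rw [Complex.div_natCast_re, mul_pow, ← Complex.ofReal_pow, Complex.re_ofReal_mul,
      ← Complex.exp_nat_mul, show (n : ℂ) * (Complex.I * (2 * π * y : ℝ)) =
        ((2 * π * n * y : ℝ) : ℂ) * Complex.I by push_cast; ring, Complex.exp_ofReal_mul_I_re]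
  rw [hseries.tsum_eq] at hsum
  exact hsum

/-- The derivative of the Clausen function away from the zeros of `1 - exp (2πiy)`. -/
lemma hasDerivAt_clausen_one {y : ℝ} (hy : ‖1 - Complex.exp (Complex.I * (2 * π * y : ℝ))‖ ≠ 0) :
    HasDerivAt (clausen 1)
      (-(2 * π * Real.log ‖1 - Complex.exp (Complex.I * (2 * π * y : ℝ))‖)) y := by
  let G : ℝ × ℝ → ℝ := fun p =>
    -(2 * π * Real.log ‖1 - p.1 * Complex.exp (Complex.I * (2 * π * p.2 : ℝ))‖)
  let s : Set ℝ := {y | ‖1 - Complex.exp (Complex.I * (2 * π * y : ℝ))‖ ≠ 0}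
  have hs : IsOpen s := isOpen_ne_fun (by fun_prop) continuous_const
  have hG (t : ℝ) (ht : t ∈ s) : ContinuousAt G (1, t) := by
    refine (ContinuousAt.mul continuousAt_const (ContinuousAt.log ?_ ?_)).neg
    · exact Continuous.continuousAt (by fun_prop)
    · simpa [s] using ht
  have hunif : TendstoLocallyUniformlyOn (fun r t => G (r, t)) (fun t => G (1, t))
      (nhdsWithin 1 (Set.Iio 1)) s := by
    rw [tendstoLocallyUniformlyOn_iff_forall_tendsto]
    intro t ht
    have h₁ : Tendsto (fun p : ℝ × ℝ => ((1 : ℝ), p.2))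
        (nhdsWithin 1 (Set.Iio 1) ×ˢ nhdsWithin t s) (nhds (1, t)) :=
      tendsto_const_nhds.prodMk_nhds (tendsto_snd.mono_right nhdsWithin_le_nhds)
    have h₂ : Tendsto (fun p : ℝ × ℝ => p)
        (nhdsWithin 1 (Set.Iio 1) ×ˢ nhdsWithin t s) (nhds (1, t)) := by
      rw [nhds_prod_eq]
      exact Filter.prod_mono nhdsWithin_le_nhds nhdsWithin_le_nhds
    have h := ((hG t ht).tendsto.comp h₁).prodMk_nhds ((hG t ht).tendsto.comp h₂)
    exact h.mono_right (nhds_le_uniformity _)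
  have h := hasDerivAt_of_tendstoLocallyUniformlyOn (f := clausen) (g := clausen 1) hs hunif
    (by
      filter_upwards [Ioo_mem_nhdsLT (zero_lt_one' ℝ)] with r hr t _
      exact hasDerivAt_clausen_of_lt_one hr.1.le hr.2 t)
    (fun t _ => tendsto_clausen t) (show y ∈ s from hy)
  simpa [G] using h

lemma clausen_one_add_int (y : ℝ) (k : ℤ) : clausen 1 (y + k) = clausen 1 y := by
  refine tsum_congr fun n => ?_
  rw [show 2 * π * n * (y + k) = 2 * π * n * y + ((n * k : ℤ) : ℝ) * (2 * π) by push_cast; ring,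
    Real.sin_add_int_mul_two_pi]

lemma clausen_one_neg (y : ℝ) : clausen 1 (-y) = -clausen 1 y := by
  rw [clausen, clausen, ← tsum_neg]
  refine tsum_congr fun n => ?_
  rw [mul_neg, Real.sin_neg]; ring

lemma clausen_zero : clausen 1 0 = 0 := by simp [clausen]

lemma norm_one_sub_exp (y : ℝ) :
    ‖1 - Complex.exp (Complex.I * (2 * π * y : ℝ))‖ = 2 * |Real.sin (π * (y - round y))| := by
  rw [norm_sub_rev, Complex.norm_exp_I_mul_ofReal_sub_one, norm_mul, Real.norm_eq_abs,
    Real.norm_eq_abs, abs_two, mul_sub, mul_comm π (round y : ℝ), Real.sin_sub_int_mul_pi, abs_mul,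
    abs_zpow, abs_neg, abs_one, one_zpow, one_mul]
  ring_nf

lemma four_mul_le_norm_one_sub_exp (y : ℝ) :
    4 * |y - round y| ≤ ‖1 - Complex.exp (Complex.I * (2 * π * y : ℝ))‖ := by
  have h := Real.mul_abs_le_abs_sin (x := π * (y - round y)) (by
    rw [abs_mul, abs_of_pos pi_pos]
    nlinarith [abs_sub_round y, pi_pos])
  rw [norm_one_sub_exp]
  rw [abs_mul, abs_of_pos pi_pos, ← mul_assoc, div_mul_cancel₀ _ pi_ne_zero] at h
  linarith

lemma hasDerivAt_clausen_one_bound {y : ℝ} (hy : 0 < |y - round y|) :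
    ∃ D, HasDerivAt (clausen 1) D y ∧ |D| ≤ 2 * π * (1 - Real.log |y - round y|) := by
  have h4 := four_mul_le_norm_one_sub_exp y
  have hpos : 0 < ‖1 - Complex.exp (Complex.I * (2 * π * y : ℝ))‖ := by linarith
  refine ⟨_, hasDerivAt_clausen_one hpos.ne', ?_⟩
  rw [abs_neg, abs_mul, abs_of_pos two_pi_pos]
  refine mul_le_mul_of_nonneg_left ?_ two_pi_pos.le
  have hhalf := abs_sub_round y
  have h2 : ‖1 - Complex.exp (Complex.I * (2 * π * y : ℝ))‖ ≤ 2 := by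
    rw [norm_one_sub_exp]; linarith [Real.abs_sin_le_one (π * (y - round y))]
  have hlog2 : Real.log 2 < 1 := by linarith [Real.log_two_lt_d9]
  have hneg : Real.log |y - round y| ≤ 0 := Real.log_nonpos hy.le (by linarith)
  rw [abs_le]
  constructor
  · have := Real.log_le_log hy ((le_mul_of_one_le_left hy.le (by norm_num)).trans h4)
    linarith
  · have := Real.log_le_log hpos h2
    linarith

lemma abs_clausen_one_le_of_pos {u : ℝ} (hu₀ : 0 ≤ u) (hu₁ : u ≤ 1 / 2) :
    |clausen 1 u| ≤ 2 * π * (u * (2 - Real.log u)) := by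
  let g : ℝ → ℝ := fun u => 2 * π * (2 * u + Real.negMulLog u)
  have hround {t : ℝ} (ht : t ∈ Set.Ioo (0 : ℝ) (1 / 2)) : round t = 0 := by
    rw [round_eq_zero_iff]; exact ⟨by linarith [ht.1], ht.2⟩
  have hg {t : ℝ} (ht : t ∈ Set.Ioo (0 : ℝ) (1 / 2)) :
      HasDerivAt g (2 * π * (1 - Real.log t)) t := by
    have := (((hasDerivAt_id t).const_mul 2).add (Real.hasDerivAt_negMulLog ht.1.ne')).const_mul
      (2 * π)
    refine this.congr_deriv ?_
    ring
  have hgc : Continuous g := by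
    have := Real.continuous_negMulLog
    fun_prop
  have hD {t : ℝ} (ht : t ∈ Set.Ioo (0 : ℝ) (1 / 2)) :
      ∃ D, HasDerivAt (clausen 1) D t ∧ |D| ≤ 2 * π * (1 - Real.log t) := by
    have := hasDerivAt_clausen_one_bound (y := t) (by
      rw [hround ht]; simpa using ht.1.ne')
    simpa [hround ht] using this
  have mono (e : ℝ) (he : |e| = 1) :
      MonotoneOn (fun t => g t + e * clausen 1 t) (Set.Icc 0 (1 / 2)) := by
    have hder {t : ℝ} (ht : t ∈ Set.Ioo (0 : ℝ) (1 / 2)) :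
        ∃ D, HasDerivAt (fun t => g t + e * clausen 1 t) D t ∧ 0 ≤ D := by
      obtain ⟨D, hD, hle⟩ := hD ht
      refine ⟨_, (hg ht).add (hD.const_mul e), ?_⟩
      have : |e * D| = |D| := by rw [abs_mul, he, one_mul]
      linarith [neg_abs_le (e * D)]
    refine monotoneOn_of_deriv_nonneg (convex_Icc _ _) ?_ ?_ ?_
    · exact (hgc.add (continuous_const.mul continuous_clausen_one)).continuousOn
    · intro t ht
      rw [interior_Icc] at ht
      obtain ⟨D, hD, -⟩ := hder ht
      exact hD.differentiableAt.differentiableWithinAt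
    · intro t ht
      rw [interior_Icc] at ht
      obtain ⟨D, hD, h⟩ := hder ht
      rwa [hD.deriv]
  have hmem : u ∈ Set.Icc (0 : ℝ) (1 / 2) := ⟨hu₀, hu₁⟩
  have h0 : (0 : ℝ) ∈ Set.Icc (0 : ℝ) (1 / 2) := ⟨le_rfl, by norm_num⟩
  have h₁ := mono 1 (by simp) h0 hmem hu₀
  have h₂ := mono (-1) (by simp) h0 hmem hu₀
  have hgu : g u = 2 * π * (u * (2 - Real.log u)) := by
    simp only [g, Real.negMulLog]; ring
  simp only [clausen_zero, g, Real.negMulLog_zero] at h₁ h₂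
  simp only [g] at hgu
  rw [← hgu, abs_le]
  constructor <;> linarith

lemma abs_clausen_one_le (y : ℝ) :
    |clausen 1 y| ≤ 2 * π * (|y - round y| * (2 - Real.log |y - round y|)) := by
  have h := abs_clausen_one_le_of_pos (abs_nonneg _) (abs_sub_round y)
  have hper : clausen 1 (y - round y) = clausen 1 y := by
    rw [← clausen_one_add_int (y - round y) (round y), sub_add_cancel]
  rcases abs_choice (y - round y) with habs | habs
  · rwa [habs, hper, ← habs] at h
  · rwa [habs, clausen_one_neg, hper, abs_neg, ← habs] at h

/-- Increments of the Clausen function are controlled by the logarithmic singularity at one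
endpoint. -/
lemma abs_clausen_one_sub_le {y z : ℝ} (hy : 0 < |y - round y|) :
    |clausen 1 z - clausen 1 y| ≤ 12 * π * (|z - y| * (2 - Real.log |y - round y|)) := by
  have hhalf := abs_sub_round y
  have hL : 1 ≤ 2 - Real.log |y - round y| := by
    linarith [Real.log_nonpos hy.le (by linarith)]
  have hdist (t : ℝ) : |y - round y| ≤ |t - round t| + |t - y| := by
    calc |y - round y| ≤ |y - round t| := round_le y _
      _ = |(t - round t) - (t - y)| := by ring_nf
      _ ≤ _ := abs_sub _ _
  set s := |y - round y| with hs
  set h := |z - y| with hh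
  have hh0 : 0 ≤ h := abs_nonneg _
  have hpi := pi_pos
  rcases lt_or_ge (2 * h) s with hlt | hge
  · have hnear {t : ℝ} (ht : t ∈ Set.uIcc y z) : s / 2 ≤ |t - round t| := by
      have := Set.abs_sub_left_of_mem_uIcc ht
      linarith [hdist t]
    have hpos {t : ℝ} (ht : t ∈ Set.uIcc y z) : 0 < |t - round t| := by linarith [hnear ht]
    have hmv := (convex_uIcc y z).norm_image_sub_le_of_norm_hasDerivWithin_le
      (f := clausen 1) (f' := deriv (clausen 1)) (C := 2 * π * (2 - Real.log s))
      (fun t ht => by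
        obtain ⟨D, hD, -⟩ := hasDerivAt_clausen_one_bound (hpos ht)
        exact hD.differentiableAt.hasDerivAt.hasDerivWithinAt)
      (fun t ht => by
        obtain ⟨D, hD, hle⟩ := hasDerivAt_clausen_one_bound (hpos ht)
        rw [hD.deriv, Real.norm_eq_abs]
        refine hle.trans (mul_le_mul_of_nonneg_left ?_ two_pi_pos.le)
        have := Real.log_le_log (by linarith) (hnear ht)
        rw [Real.log_div hy.ne' two_ne_zero] at this
        linarith [Real.log_two_lt_d9])
      Set.left_mem_uIcc Set.right_mem_uIcc
    rw [Real.norm_eq_abs, Real.norm_eq_abs, ← hh] at hmv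
    have : 0 ≤ π * (h * (2 - Real.log s)) := by positivity
    linarith
  · have hCy := abs_clausen_one_le y
    have hCz := abs_clausen_one_le z
    rw [← hs] at hCy
    have hz : |z - round z| ≤ s + h := by
      have : |z - round z| ≤ |z - round y| := round_le z _
      have h' : |z - round y| ≤ |y - round y| + |z - y| := by
        rw [show z - round y = (y - round y) + (z - y) by ring]; exact abs_add_le _ _
      linarith
    set s' := |z - round z| with hs'
    have hs'0 : 0 ≤ s' := abs_nonneg _
    have key : s' * (2 - Real.log s') ≤ 2 * h * (2 - Real.log s) + 2 * h * (2 - Real.log s) := by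
      rcases le_or_gt s s' with hss | hss
      · have := Real.log_le_log hy hss
        nlinarith
      · rcases hs'0.eq_or_lt with h0 | h0
        · rw [← h0, zero_mul]; positivity
        · have hlog := Real.log_le_sub_one_of_pos (div_pos hy h0)
          rw [Real.log_div hy.ne' h0.ne'] at hlog
          have h1 : s' * (Real.log s - Real.log s') ≤ s := by
            calc s' * (Real.log s - Real.log s') ≤ s' * (s / s' - 1) := by gcongr
              _ = s - s' := by field_simp
              _ ≤ s := by linarith
          nlinarith
    have hsum : |clausen 1 z - clausen 1 y| ≤ |clausen 1 z| + |clausen 1 y| := abs_sub _ _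
    have hsy : s * (2 - Real.log s) ≤ 2 * h * (2 - Real.log s) := by gcongr
    nlinarith

/-- The numerators of the continued fraction convergents of `x ∈ (0, 1)`. -/
def pnum (x : ℝ) : ℕ → ℤ
  | 0 => 0
  | 1 => 1
  | n + 2 => ⌊(gauss^[n + 1] x)⁻¹⌋ * pnum x (n + 1) + pnum x n

lemma gauss_iterate_mem {x : ℝ} (hx : x ∈ Set.Ioo (0 : ℝ) 1) (hirr : Irrational x) (n : ℕ) :
    gauss^[n] x ∈ Set.Ioo (0 : ℝ) 1 ∧ Irrational (gauss^[n] x) := by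
  induction n with
  | zero => exact ⟨hx, hirr⟩
  | succ n ih =>
    have hi : Irrational (Int.fract (gauss^[n] x)⁻¹) := by
      rw [Int.fract]
      exact ih.2.inv.sub_intCast _
    rw [Function.iterate_succ_apply', gauss, if_neg ih.2.ne_zero]
    exact ⟨⟨(Int.fract_nonneg _).lt_of_ne hi.ne_zero.symm, Int.fract_lt_one _⟩, hi⟩

lemma floor_add_gauss_iterate {x : ℝ} (hx : x ∈ Set.Ioo (0 : ℝ) 1) (hirr : Irrational x) (n : ℕ) :
    (⌊(gauss^[n] x)⁻¹⌋ : ℝ) + gauss^[n + 1] x = (gauss^[n] x)⁻¹ := by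
  rw [Function.iterate_succ_apply', gauss, if_neg (gauss_iterate_mem hx hirr n).2.ne_zero,
    Int.floor_add_fract]

lemma one_le_floor_gauss_iterate {x : ℝ} (hx : x ∈ Set.Ioo (0 : ℝ) 1) (hirr : Irrational x)
    (n : ℕ) : 1 ≤ ⌊(gauss^[n] x)⁻¹⌋ := by
  have h := (gauss_iterate_mem hx hirr n).1
  rw [Int.le_floor, Int.cast_one]
  exact (one_le_inv₀ h.1).2 h.2.le

lemma one_le_qden_and_le_succ {x : ℝ} (hx : x ∈ Set.Ioo (0 : ℝ) 1) (hirr : Irrational x)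
    (n : ℕ) : 1 ≤ qden x n ∧ qden x n ≤ qden x (n + 1) := by
  induction n with
  | zero => simpa [qden] using one_le_floor_gauss_iterate hx hirr 0
  | succ n ih =>
    obtain ⟨h₁, h₂⟩ := ih
    have ha := one_le_floor_gauss_iterate hx hirr (n + 1)
    refine ⟨by lia, ?_⟩
    rw [qden]
    nlinarith

lemma natCast_le_qden {x : ℝ} (hx : x ∈ Set.Ioo (0 : ℝ) 1) (hirr : Irrational x) (n : ℕ) :
    (n : ℤ) ≤ qden x n := by
  induction n with
  | zero => simp [qden]
  | succ n ih =>
    rcases n with _ | n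
    · simpa [qden] using one_le_floor_gauss_iterate hx hirr 0
    · have ha := one_le_floor_gauss_iterate hx hirr (n + 1)
      have h₁ := (one_le_qden_and_le_succ hx hirr n).1
      have h₂ := (one_le_qden_and_le_succ hx hirr (n + 1)).1
      rw [qden]
      push_cast at ih ⊢
      nlinarith

lemma qden_mul_sub_pnum_succ {x : ℝ} (hx : x ∈ Set.Ioo (0 : ℝ) 1) (hirr : Irrational x) (n : ℕ) :
    qden x (n + 1) * x - pnum x (n + 1) = -(gauss^[n + 1] x * (qden x n * x - pnum x n)) := by
  induction n with
  | zero =>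
    have h := floor_add_gauss_iterate hx hirr 0
    have h0 : x ≠ 0 := hx.1.ne'
    simp only [Function.iterate_zero, id_eq, zero_add] at h
    simp only [qden, pnum, zero_add]
    rw [eq_sub_of_add_eq h]
    push_cast
    field_simp
    ring
  | succ n ih =>
    have h := floor_add_gauss_iterate hx hirr (n + 1)
    have h0 : gauss^[n + 1] x ≠ 0 := (gauss_iterate_mem hx hirr (n + 1)).2.ne_zero
    have h' : (qden x n * x - pnum x n) =
        -((gauss^[n + 1] x)⁻¹ * (qden x (n + 1) * x - pnum x (n + 1))) := by
      rw [ih]; field_simp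
    rw [← h] at h'
    simp only [qden, pnum]
    push_cast
    linear_combination h'

/-- The exact formula for the approximation error of a convergent. -/
lemma abs_qden_mul_sub_pnum {x : ℝ} (hx : x ∈ Set.Ioo (0 : ℝ) 1) (hirr : Irrational x) (n : ℕ) :
    |qden x n * x - pnum x n| * (qden x (n + 1) + qden x n * gauss^[n + 1] x) = 1 := by
  induction n with
  | zero =>
    have h := floor_add_gauss_iterate hx hirr 0
    simp only [Function.iterate_zero, id_eq, zero_add] at h
    simp only [qden, pnum, zero_add, Int.cast_one, one_mul, Int.cast_zero, sub_zero]
    rw [h, abs_of_pos hx.1, mul_inv_cancel₀ hx.1.ne']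
  | succ n ih =>
    have h := floor_add_gauss_iterate hx hirr (n + 1)
    have h0 := (gauss_iterate_mem hx hirr (n + 1)).1.1
    have hmul : gauss^[n + 1] x * (⌊(gauss^[n + 1] x)⁻¹⌋ + gauss^[n + 1 + 1] x) = 1 := by
      rw [h, mul_inv_cancel₀ h0.ne']
    rw [qden_mul_sub_pnum_succ hx hirr, abs_neg, abs_mul, abs_of_pos h0]
    simp only [qden]
    push_cast
    linear_combination ih + |qden x n * x - pnum x n| * qden x (n + 1) * hmul

lemma abs_qden_mul_sub_pnum_le {x : ℝ} (hx : x ∈ Set.Ioo (0 : ℝ) 1) (hirr : Irrational x)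
    (n : ℕ) : |qden x n * x - pnum x n| * qden x (n + 1) ≤ 1 := by
  have hq : (1 : ℝ) ≤ qden x n := by exact_mod_cast (one_le_qden_and_le_succ hx hirr n).1
  have ht := (gauss_iterate_mem hx hirr (n + 1)).1.1
  rw [← abs_qden_mul_sub_pnum hx hirr n]
  gcongr
  nlinarith

lemma one_le_abs_qden_mul_sub_pnum {x : ℝ} (hx : x ∈ Set.Ioo (0 : ℝ) 1) (hirr : Irrational x)
    (n : ℕ) : 1 ≤ |qden x n * x - pnum x n| * (2 * qden x (n + 1)) := by
  have hq : (1 : ℝ) ≤ qden x n := by exact_mod_cast (one_le_qden_and_le_succ hx hirr n).1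
  have hq' : (qden x n : ℝ) ≤ qden x (n + 1) := by
    exact_mod_cast (one_le_qden_and_le_succ hx hirr n).2
  have ht := (gauss_iterate_mem hx hirr (n + 1)).1.2
  rw [← abs_qden_mul_sub_pnum hx hirr n]
  gcongr
  nlinarith

lemma qden_mul_pnum_sub (x : ℝ) (n : ℕ) :
    qden x (n + 1) * pnum x n - qden x n * pnum x (n + 1) = -(-1) ^ n := by
  induction n with
  | zero => simp [qden, pnum]
  | succ n ih =>
    simp only [qden, pnum]
    rw [pow_succ]
    linear_combination -ih

lemma isCoprime_qden_pnum (x : ℝ) (n : ℕ) : IsCoprime (qden x n) (pnum x n) := by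
  have h := qden_mul_pnum_sub x n
  have hsq : ((-1 : ℤ) ^ n) * (-1) ^ n = 1 := by rw [← mul_pow]; simp
  exact ⟨(-1) ^ n * pnum x (n + 1), -(-1) ^ n * qden x (n + 1), by
    linear_combination -(-1) ^ n * h + hsq⟩

/-- A form of Legendre's theorem: `m` is a bad denominator only if it is a multiple of some
`qden x n`. -/
lemma exists_qden_mul_eq {x : ℝ} (hx : x ∈ Set.Ioo (0 : ℝ) 1) (hirr : Irrational x) {m : ℕ}
    (hm : 0 < m) : ∃ n k : ℕ, (m : ℤ) = k * qden x n ∧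
      1 ≤ |m * x - round (m * x)| * (4 * m * (2 * qden x (n + 1))) := by
  set p : ℤ := round (m * x) with hp
  have hm1 : (1 : ℝ) ≤ m := by exact_mod_cast hm
  have hex : ∃ n, 2 * (|qden x n * x - pnum x n| * m) ≤ 1 := by
    refine ⟨2 * m, ?_⟩
    have h := abs_qden_mul_sub_pnum_le hx hirr (2 * m)
    have hq : (2 * m : ℝ) ≤ qden x (2 * m + 1) := by
      have h₁ := natCast_le_qden hx hirr (2 * m + 1)
      have : ((2 * m : ℕ) : ℤ) ≤ qden x (2 * m + 1) := by push_cast at h₁ ⊢; linarith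
      exact_mod_cast this
    calc 2 * (|qden x (2 * m) * x - pnum x (2 * m)| * m)
        = |qden x (2 * m) * x - pnum x (2 * m)| * (2 * m) := by ring
      _ ≤ |qden x (2 * m) * x - pnum x (2 * m)| * qden x (2 * m + 1) := by gcongr
      _ ≤ 1 := h
  classical
  obtain ⟨n, hn, hmin⟩ : ∃ n, 2 * (|qden x n * x - pnum x n| * m) ≤ 1 ∧
      ∀ k < n, ¬ 2 * (|qden x k * x - pnum x k| * m) ≤ 1 :=
    ⟨Nat.find hex, Nat.find_spec hex, fun k hk => Nat.find_min hex hk⟩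
  have hqpos (j : ℕ) : (1 : ℝ) ≤ qden x j := by
    exact_mod_cast (one_le_qden_and_le_succ hx hirr j).1
  have hqn : (qden x n : ℝ) ≤ 2 * m := by
    rcases n with _ | n
    · simp only [qden, Int.cast_one]; linarith
    · have h := abs_qden_mul_sub_pnum_le hx hirr n
      have h' := not_le.1 (hmin n n.lt_succ_self)
      have he : 0 ≤ |qden x n * x - pnum x n| := abs_nonneg _
      by_contra! hlt
      nlinarith
  by_cases heq : p * qden x n = m * pnum x n
  · obtain ⟨k, hk⟩ : qden x n ∣ (m : ℤ) := (isCoprime_qden_pnum x n).dvd_of_dvd_mul_right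
      ⟨p, by rw [← heq]; ring⟩
    have hqz : 1 ≤ qden x n := (one_le_qden_and_le_succ hx hirr n).1
    have hk1 : 1 ≤ k := by
      by_contra! hlt
      have : (0 : ℤ) < m := by exact_mod_cast hm
      nlinarith
    have hpk : p = k * pnum x n := by
      rw [hk] at heq
      exact mul_right_cancel₀ (show qden x n ≠ 0 by lia) (by rw [heq]; ring)
    refine ⟨n, k.toNat, by rw [Int.toNat_of_nonneg (by lia), hk, mul_comm], ?_⟩
    have hmk : (m : ℝ) = qden x n * k := by exact_mod_cast hk
    have herr : m * x - p = k * (qden x n * x - pnum x n) := by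
      rw [hmk, hpk]; push_cast; ring
    have hk1' : (1 : ℝ) ≤ k := by exact_mod_cast hk1
    have hb := one_le_abs_qden_mul_sub_pnum hx hirr n
    rw [herr, abs_mul, abs_of_pos (by linarith : (0 : ℝ) < k)]
    have hQ := hqpos (n + 1)
    calc (1 : ℝ) ≤ 1 * (1 * (|qden x n * x - pnum x n| * (2 * qden x (n + 1)))) := by linarith
      _ ≤ k * ((4 * m) * (|qden x n * x - pnum x n| * (2 * qden x (n + 1)))) := by
        gcongr
        linarith
      _ = _ := by ring
  · have h1 : (1 : ℝ) ≤ |(p * qden x n - m * pnum x n : ℝ)| := by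
      have : 1 ≤ |p * qden x n - m * pnum x n| := Int.one_le_abs (sub_ne_zero.2 heq)
      exact_mod_cast this
    have h2 : |(p * qden x n - m * pnum x n : ℝ)| ≤
        |qden x n * x - pnum x n| * m + |m * x - p| * qden x n := by
      have hm0 : |(m : ℝ)| = m := Nat.abs_cast m
      have hq0 : |(qden x n : ℝ)| = qden x n := abs_of_pos (by linarith [hqpos n])
      calc |(p * qden x n - m * pnum x n : ℝ)|
          = |(qden x n * x - pnum x n) * m - (m * x - p) * qden x n| := by ring_nf
        _ ≤ |(qden x n * x - pnum x n) * m| + |(m * x - p) * qden x n| := abs_sub _ _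
        _ = _ := by rw [abs_mul, abs_mul, hm0, hq0]
    refine ⟨0, m, by simp [qden], ?_⟩
    have hQ := hqpos 1
    have he : 0 ≤ |m * x - p| := abs_nonneg _
    calc (1 : ℝ) ≤ 2 * (|m * x - p| * qden x n) := by linarith
      _ ≤ 2 * (|m * x - p| * (2 * m)) := by gcongr
      _ = |m * x - p| * (4 * m * 1) := by ring
      _ ≤ |m * x - p| * (4 * m * (2 * qden x (0 + 1))) := by
        gcongr
        rw [zero_add]
        linarith

/-- For a square-Brjuno number, `∑ -log ‖m x‖ / m²` converges. -/
lemma SquareBrjuno.summable_log_dist {x : ℝ} (hx : x ∈ Set.Ioo (0 : ℝ) 1) (hirr : Irrational x)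
    (hB : SquareBrjuno x) :
    Summable fun m : ℕ => -Real.log |m * x - round (m * x)| / (m : ℝ) ^ 2 := by
  have hqpos (j : ℕ) : (1 : ℝ) ≤ qden x j := by
    exact_mod_cast (one_le_qden_and_le_succ hx hirr j).1
  have hB' : Summable fun n : ℕ => Real.log (2 * qden x (n + 1)) / (qden x n : ℝ) ^ 2 := by
    rw [SquareBrjuno, ← summable_nat_add_iff 1] at hB
    rw [← summable_nat_add_iff 1]
    refine Summable.of_nonneg_of_le (fun n => ?_) (fun n => ?_) (hB.mul_left 2)
    · have := Real.log_nonneg (show (1 : ℝ) ≤ 2 * qden x (n + 1 + 1) by linarith [hqpos (n + 1 + 1)])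
      positivity
    · have h2 : (2 : ℝ) ≤ qden x (n + 1 + 1) := by
        have := natCast_le_qden hx hirr (n + 1 + 1)
        have : (2 : ℤ) ≤ qden x (n + 1 + 1) := by push_cast at this; lia
        exact_mod_cast this
      rw [Real.log_mul two_ne_zero (by linarith), ← mul_div_assoc]
      have := Real.log_le_log two_pos h2
      gcongr
      linarith
  have hlog : Summable fun m : ℕ => Real.log (4 * m) / (m : ℝ) ^ 2 := by
    have hs : Summable fun m : ℕ => 4 * (1 / (m : ℝ) ^ (3 / 2 : ℝ)) :=
      (Real.summable_one_div_nat_rpow.2 (by norm_num)).mul_left 4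
    refine Summable.of_nonneg_of_le (fun m => ?_) (fun m => ?_) hs
    · rcases m.eq_zero_or_pos with rfl | hm
      · simp
      · have hm1 : (1 : ℝ) ≤ m := by exact_mod_cast hm
        have := Real.log_nonneg (show (1 : ℝ) ≤ 4 * m by linarith)
        positivity
    · rcases m.eq_zero_or_pos with rfl | hm
      · simp
      · have hm1 : (0 : ℝ) < m := by exact_mod_cast hm
        have h := Real.log_le_rpow_div (show (0 : ℝ) ≤ 4 * m by linarith)
          (show (0 : ℝ) < 1 / 2 by norm_num)
        have h4 : (4 : ℝ) ^ (1 / 2 : ℝ) = 2 := by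
          rw [← Real.sqrt_eq_rpow, show (4 : ℝ) = 2 ^ 2 by norm_num, Real.sqrt_sq two_pos.le]
        rw [Real.mul_rpow (by norm_num) hm1.le, h4] at h
        have hpow : (m : ℝ) ^ (1 / 2 : ℝ) * (m : ℝ) ^ (3 / 2 : ℝ) = (m : ℝ) ^ 2 := by
          rw [← Real.rpow_add hm1, ← Real.rpow_natCast]; norm_num
        have hp : (0 : ℝ) < (m : ℝ) ^ (3 / 2 : ℝ) := by positivity
        rw [mul_one_div, div_le_div_iff₀ (by positivity) hp, ← hpow]
        calc _ ≤ (2 * (m : ℝ) ^ (1 / 2 : ℝ) / (1 / 2)) * (m : ℝ) ^ (3 / 2 : ℝ) := by gcongr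
          _ = _ := by ring
  have hpair : Summable fun c : ℕ × ℕ =>
      ((c.1 : ℝ) ^ 2)⁻¹ * (Real.log (2 * qden x (c.2 + 1)) / (qden x c.2 : ℝ) ^ 2) := by
    refine (Real.summable_nat_pow_inv.2 one_lt_two).mul_of_nonneg hB' (fun n => ?_) fun n => ?_
    · positivity
    · have := Real.log_nonneg (show (1 : ℝ) ≤ 2 * qden x (n + 1) by linarith [hqpos (n + 1)])
      positivity
  rw [← summable_nat_add_iff 1] at hlog ⊢
  choose n k hmk hbound using fun m : ℕ => exists_qden_mul_eq hx hirr m.succ_pos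
  have hinj : Function.Injective fun m => (k m, n m) := by
    intro a b hab
    simp only [Prod.mk.injEq] at hab
    have : ((a + 1 : ℕ) : ℤ) = (b + 1 : ℕ) := by
      rw [← Nat.succ_eq_add_one, ← Nat.succ_eq_add_one, hmk a, hmk b, hab.1, hab.2]
    lia
  refine Summable.of_nonneg_of_le (fun m => ?_) (fun m => ?_)
    (hlog.add (hpair.comp_injective hinj))
  · have := abs_sub_round (((m + 1 : ℕ) : ℝ) * x)
    have := Real.log_nonpos (abs_nonneg _)
      (show |((m + 1 : ℕ) : ℝ) * x - round (((m + 1 : ℕ) : ℝ) * x)| ≤ 1 by linarith)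
    have : 0 ≤ -Real.log |((m + 1 : ℕ) : ℝ) * x - round (((m + 1 : ℕ) : ℝ) * x)| := by linarith
    positivity
  · have hb := hbound m
    rw [Nat.succ_eq_add_one] at hb
    set M : ℕ := m + 1 with hM
    have hM0 : (0 : ℝ) < M := by positivity
    have hQ := hqpos (n m + 1)
    have hs : |(M : ℝ) * x - round ((M : ℝ) * x)| ≠ 0 := by
      intro h0
      rw [h0, zero_mul] at hb
      linarith
    have hl := Real.log_nonneg hb
    rw [Real.log_mul hs (by positivity), Real.log_mul (by positivity) (by positivity)] at hl
    have hMk : (M : ℝ) = k m * qden x (n m) := by exact_mod_cast hmk m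
    have hterm : ((k m : ℝ) ^ 2)⁻¹ * (Real.log (2 * qden x (n m + 1)) / (qden x (n m) : ℝ) ^ 2) =
        Real.log (2 * qden x (n m + 1)) / (M : ℝ) ^ 2 := by
      rw [hMk, mul_pow, div_mul_eq_div_div_swap, mul_comm, div_eq_mul_inv _ ((k m : ℝ) ^ 2)]
    simp only [Function.comp_apply]
    rw [hterm, ← add_div]
    gcongr
    linarith

lemma summable_clausen_multiples (x : ℝ) :
    Summable fun m : ℕ => ((m : ℝ) ^ 3)⁻¹ * clausen 1 (m * x) := by
  refine Summable.of_norm_bounded ((Real.summable_nat_pow_inv.2 (show 1 < 3 by norm_num)).mul_right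
    (∑' n : ℕ, ((n : ℝ) ^ 2)⁻¹)) fun m => ?_
  rw [norm_mul, Real.norm_of_nonneg (by positivity : (0 : ℝ) ≤ ((m : ℝ) ^ 3)⁻¹)]
  gcongr
  exact tsum_of_norm_bounded summable_inv_nat_sq.hasSum
    fun n => norm_clausen_term_le zero_le_one le_rfl n _

/-- The summand of `F2` regrouped over all pairs `(d, m)` of positive integers. -/
def pairTerm (x : ℝ) (c : ℕ+ × ℕ+) : ℝ :=
  (((c.1 : ℕ) : ℝ) ^ 2)⁻¹ * (((c.2 : ℕ) : ℝ) ^ 3)⁻¹ *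
    Real.sin (2 * π * ((c.1 : ℕ) * (c.2 : ℕ) : ℕ) * x)

lemma summable_pairTerm (x : ℝ) : Summable (pairTerm x) := by
  have hinv (k : ℕ) (hk : 1 < k) : Summable fun d : ℕ+ => (((d : ℕ) : ℝ) ^ k)⁻¹ :=
    (Real.summable_nat_pow_inv.2 hk).comp_injective PNat.coe_injective
  refine Summable.of_norm_bounded
    ((hinv 2 (by norm_num)).mul_of_nonneg (hinv 3 (by norm_num)) (fun _ => by positivity)
      fun _ => by positivity) fun c => ?_
  rw [pairTerm, norm_mul, Real.norm_of_nonneg (by positivity)]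
  exact mul_le_of_le_one_right (by positivity) (Real.abs_sin_le_one _)

lemma pairTerm_sigmaAntidiagonal (x : ℝ) (n : ℕ+) (c : Nat.divisorsAntidiagonal n) :
    pairTerm x (sigmaAntidiagonalEquivProd ⟨n, c⟩) =
      (c.1.1 : ℝ) / ((n : ℕ) : ℝ) ^ 3 * Real.sin (2 * π * (n : ℕ) * x) := by
  obtain ⟨⟨a, b⟩, hc⟩ := c
  obtain ⟨hab, hn⟩ := Nat.mem_divisorsAntidiagonal.1 hc
  have ha : (a : ℝ) ≠ 0 := Nat.cast_ne_zero.2 (left_ne_zero_of_mul (hab ▸ hn))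
  have hb : (b : ℝ) ≠ 0 := Nat.cast_ne_zero.2 (right_ne_zero_of_mul (hab ▸ hn))
  change ((a : ℝ) ^ 2)⁻¹ * ((b : ℝ) ^ 3)⁻¹ * Real.sin (2 * π * (a * b : ℕ) * x) =
    (a : ℝ) / ((n : ℕ) : ℝ) ^ 3 * Real.sin (2 * π * (n : ℕ) * x)
  rw [show a * b = (n : ℕ) from hab]
  congr 1
  rw [← show a * b = (n : ℕ) from hab]
  push_cast
  field_simp

lemma tsum_pairTerm (x : ℝ) : ∑' c, pairTerm x c = F2 x := by
  have hsum : Summable fun c => pairTerm x (sigmaAntidiagonalEquivProd c) :=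
    sigmaAntidiagonalEquivProd.summable_iff.2 (summable_pairTerm x)
  rw [← sigmaAntidiagonalEquivProd.tsum_eq, hsum.tsum_sigma, F2]
  have hs := tsum_pnat_eq_tsum_succ
    (f := fun n : ℕ => (sigma1 n : ℝ) / (n : ℝ) ^ 3 * Real.sin (2 * π * n * x))
  push_cast at hs
  rw [← hs]
  refine tsum_congr fun n => ?_
  simp only [pairTerm_sigmaAntidiagonal]
  rw [tsum_fintype, Finset.univ_eq_attach,
    Finset.sum_attach _ (fun c : ℕ × ℕ =>
      (c.1 : ℝ) / ((n : ℕ) : ℝ) ^ 3 * Real.sin (2 * π * (n : ℕ) * x)),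
    Nat.sum_divisorsAntidiagonal (fun a _ =>
      (a : ℝ) / ((n : ℕ) : ℝ) ^ 3 * Real.sin (2 * π * (n : ℕ) * x)),
    ← Finset.sum_mul, ← Finset.sum_div, sigma1]
  push_cast
  rfl

/-- The Clausen function expansion of `F2`. -/
lemma F2_eq_tsum_clausen (x : ℝ) : F2 x = ∑' m : ℕ, ((m : ℝ) ^ 3)⁻¹ * clausen 1 (m * x) := by
  have hsucc (f : ℕ → ℝ) (hf : Summable f) (h0 : f 0 = 0) : ∑' n, f n = ∑' n : ℕ+, f n := by
    rw [tsum_pnat_eq_tsum_succ, hf.tsum_eq_zero_add, h0, zero_add]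
  have hsum : Summable fun c => pairTerm x (Equiv.prodComm ℕ+ ℕ+ c) :=
    (Equiv.prodComm ℕ+ ℕ+).summable_iff.2 (summable_pairTerm x)
  rw [← tsum_pairTerm, ← (Equiv.prodComm _ _).tsum_eq, hsum.tsum_prod,
    hsucc _ (summable_clausen_multiples x) (by simp)]
  refine tsum_congr fun m => ?_
  rw [clausen, hsucc, ← tsum_mul_left]
  · refine tsum_congr fun d => ?_
    simp only [pairTerm, Equiv.prodComm_apply, Prod.swap_prod_mk, one_pow, one_mul, div_eq_mul_inv]
    push_cast
    ring_nf
  · exact Summable.of_norm_bounded summable_inv_nat_sq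
      fun n => norm_clausen_term_le zero_le_one le_rfl n _
  · simp

/-- If `x ∈ (0,1)` is an irrational square-Brjuno number satisfying (*) or (**),
then `F₂` is differentiable at `x`. -/
theorem F2_differentiableAt_of_squareBrjuno (x : ℝ) (hx : x ∈ Set.Ioo (0 : ℝ) 1)
    (hirr : Irrational x) (hB : SquareBrjuno x) (hc : CondStar x ∨ CondStarStar x) :
    DifferentiableAt ℝ F2 x := by
  have hdist (m : ℕ) (hm : m ≠ 0) : 0 < |m * x - round (m * x)| :=
    abs_pos.2 (((hirr.natCast_mul hm).sub_intCast _).ne_zero)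
  let f : ℕ → ℝ → ℝ := fun m y => ((m : ℝ) ^ 3)⁻¹ * clausen 1 (m * y)
  have hF : F2 = fun y => ∑' m, f m y := funext F2_eq_tsum_clausen
  have hf (y : ℝ) : Summable fun m => f m y := summable_clausen_multiples y
  have hderiv (m : ℕ) : ∃ D, HasDerivAt (f m) D x := by
    rcases eq_or_ne m 0 with rfl | hm
    · exact ⟨0, by simpa [f] using hasDerivAt_const x (0 : ℝ)⟩
    · obtain ⟨D, hD, -⟩ := hasDerivAt_clausen_one_bound (hdist m hm)
      exact ⟨_, ((HasDerivAt.comp x hD ((hasDerivAt_id x).const_mul (m : ℝ))).const_mul _)⟩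
  choose D hD using hderiv
  let b : ℕ → ℝ := fun m =>
    12 * π * (2 * ((m : ℝ) ^ 2)⁻¹ + -Real.log |m * x - round (m * x)| / (m : ℝ) ^ 2)
  have hb : Summable b :=
    ((summable_inv_nat_sq.mul_left 2).add (hB.summable_log_dist hx hirr)).mul_left _
  have hbound (m : ℕ) (y : ℝ) (hy : y ≠ x) : ‖slope (f m) x y‖ ≤ b m := by
    rcases eq_or_ne m 0 with rfl | hm
    · simp [slope_def_field, f, b]
    · have hm0 : (0 : ℝ) < m := by positivity
      have h := abs_clausen_one_sub_le (z := m * y) (hdist m hm)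
      rw [← mul_sub, abs_mul, Nat.abs_cast] at h
      rw [slope_def_field, norm_div, Real.norm_eq_abs, Real.norm_eq_abs,
        div_le_iff₀ (abs_pos.2 (sub_ne_zero.2 hy))]
      simp only [f, b]
      rw [← mul_sub, abs_mul, abs_of_pos (by positivity : (0 : ℝ) < ((m : ℝ) ^ 3)⁻¹)]
      refine (mul_le_mul_of_nonneg_left h (by positivity)).trans (le_of_eq ?_)
      field_simp
      ring
  have hslope (y : ℝ) : slope F2 x y = ∑' m, slope (f m) x y := by
    simp only [slope_def_field, hF]
    rw [tsum_div_const, (hf y).tsum_sub (hf x)]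
  have hlim : HasDerivAt F2 (∑' m, D m) x := by
    rw [hasDerivAt_iff_tendsto_slope, funext hslope]
    refine tendsto_tsum_of_dominated_convergence hb (fun m => ?_) ?_
    · exact hasDerivAt_iff_tendsto_slope.1 (hD m)
    · filter_upwards [self_mem_nhdsWithin] with y hy m
      exact hbound m y hy
  exact hlim.differentiableAt

end
end

section
/- Let p/q ∈ ℚ be in lowest terms with q ≥ 1 (for the point 0 take p = 0, q = 1). Then there exists a constant C̃ ∈ ℂ such that: (a) as x → (p/q)^+, φ_2(x) = φ_2(p/q) − (iπ^3/(3q^3))·(qx−p)·log(qx−p) + C̃·(qx−p) + O((qx−p)^2·log(qx−p)); and (b) as x → (p/q)^−, φ_2(x) = φ_2(p/q) − (iπ^3/(3q^3))·(qx−p)·log|qx−p| + (C̃ + π^4/(3q^3))·(qx−p) + O((qx−p)^2·log|qx−p|). -/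
open Real Complex Asymptotics Filter

noncomputable section

/-- `φ₂(x) = ∑_{n=1}^∞ σ₁(n)/n³ · e^{2πinx}` for real `x`. -/
def phi2 (x : ℝ) : ℂ :=
  ∑' n : ℕ, (sigma1 (n + 1) : ℂ) / ((n : ℂ) + 1) ^ 3 *
    Complex.exp (2 * (Real.pi : ℂ) * Complex.I * ((n : ℂ) + 1) * (x : ℂ))

/-- The series `∑ σ₁(n) / n ^ k * e^{2πinz}`. -/
def sigmaSeries (k : ℕ) (z : ℂ) : ℂ :=
  ∑' n : ℕ, (sigma1 (n + 1) : ℂ) / ((n : ℂ) + 1) ^ k *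
    Complex.exp (2 * (Real.pi : ℂ) * Complex.I * ((n : ℂ) + 1) * z)

lemma summable_sigma1_div_rpow :
    Summable fun n : ℕ => (sigma1 (n + 1) : ℝ) / ((n : ℝ) + 1) ^ (5 / 2 : ℝ) := by
  have h1 : LSeriesSummable (fun n => ((ArithmeticFunction.zeta : ArithmeticFunction ℂ)) n)
      ((5 / 2 : ℝ) : ℂ) :=
    ArithmeticFunction.LSeriesSummable_zeta_iff.mpr (by rw [Complex.ofReal_re]; norm_num)
  have h2 : LSeriesSummable
      (fun n => ((ArithmeticFunction.pow 1 : ArithmeticFunction ℕ) : ArithmeticFunction ℂ) n)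
      ((5 / 2 : ℝ) : ℂ) := by
    refine LSeriesSummable_of_le_const_mul_rpow (x := 2) (by rw [Complex.ofReal_re]; norm_num)
      ⟨1, fun n hn => ?_⟩
    norm_num [ArithmeticFunction.pow_apply]
  have h3 := ArithmeticFunction.LSeriesSummable_mul h1 h2
  rw [← ArithmeticFunction.natCoe_mul, ArithmeticFunction.zeta_mul_pow_eq_sigma] at h3
  have h4 := ((summable_nat_add_iff 1).mpr h3).norm
  refine h4.congr fun n => ?_
  rw [LSeries.norm_term_eq]
  simp only [Nat.add_eq_zero_iff, one_ne_zero, and_false, if_false, Complex.ofReal_re,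
    ArithmeticFunction.natCoe_apply, Complex.norm_natCast, ArithmeticFunction.sigma_one_apply,
    sigma1, Nat.cast_add, Nat.cast_one]

lemma exp_neg_le_div_rpow {a x : ℝ} (ha : 0 ≤ a) (ha3 : a ≤ 3) (hx : 0 < x) :
    Real.exp (-x) ≤ 6 / x ^ a := by
  have hxa : x ^ a ≤ 6 * Real.exp x := by
    rcases le_total x 1 with h | h
    · linarith [Real.rpow_le_one hx.le h ha, Real.one_le_exp hx.le]
    · have h3 := Real.pow_div_factorial_le_exp x hx.le 3
      have h4 := Real.rpow_le_rpow_of_exponent_le h ha3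
      rw [show (3 : ℝ) = ((3 : ℕ) : ℝ) by norm_num, Real.rpow_natCast] at h4
      norm_num [Nat.factorial] at h3
      linarith
  rw [le_div_iff₀ (by positivity), Real.exp_neg, inv_mul_le_iff₀ (Real.exp_pos x)]
  linarith

lemma norm_exp_two_pi_mul (n : ℕ) (z : ℂ) :
    ‖Complex.exp (2 * (Real.pi : ℂ) * Complex.I * ((n : ℂ) + 1) * z)‖
      = Real.exp (-(2 * Real.pi * (n + 1) * z.im)) := by
  rw [Complex.norm_exp]
  congr 1
  have : 2 * (Real.pi : ℂ) * Complex.I * ((n : ℂ) + 1) * z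
      = ((2 * Real.pi * (n + 1) : ℝ) : ℂ) * (Complex.I * z) := by push_cast; ring
  rw [this, Complex.re_ofReal_mul]
  simp

lemma norm_sigmaSeries_term_le {k : ℕ} (hk : k ≤ 2) (n : ℕ) {z : ℂ} (hz : 0 < z.im) :
    ‖(sigma1 (n + 1) : ℂ) / ((n : ℂ) + 1) ^ k *
      Complex.exp (2 * (Real.pi : ℂ) * Complex.I * ((n : ℂ) + 1) * z)‖
      ≤ 6 / z.im ^ (5 / 2 - k : ℝ) *
        ((sigma1 (n + 1) : ℝ) / ((n : ℝ) + 1) ^ (5 / 2 : ℝ)) := by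
  have hn : (0 : ℝ) < (n : ℝ) + 1 := by positivity
  have hk' : (k : ℝ) ≤ 2 := by exact_mod_cast hk
  have hk0 : (0 : ℝ) ≤ k := by positivity
  have hnorm : ‖(n : ℂ) + 1‖ = (n : ℝ) + 1 := by
    rw [← Nat.cast_succ, Complex.norm_natCast, Nat.cast_succ]
  rw [norm_mul, norm_div, norm_pow, hnorm, Complex.norm_natCast, norm_exp_two_pi_mul]
  have h1 : Real.exp (-(2 * Real.pi * (n + 1) * z.im))
      ≤ 6 / (((n : ℝ) + 1) ^ (5 / 2 - k : ℝ) * z.im ^ (5 / 2 - k : ℝ)) := by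
    rw [← Real.mul_rpow hn.le hz.le]
    refine le_trans (Real.exp_le_exp.mpr ?_)
      (exp_neg_le_div_rpow (by linarith) (by linarith) (mul_pos hn hz))
    have := Real.pi_gt_three
    nlinarith [mul_pos hn hz]
  refine (mul_le_mul_of_nonneg_left h1 (by positivity)).trans (le_of_eq ?_)
  rw [Real.rpow_sub hn, Real.rpow_natCast]
  field_simp

lemma norm_sigmaSeries_le {k : ℕ} (hk : k ≤ 2) : ∃ C : ℝ, 0 ≤ C ∧ ∀ z : ℂ, 0 < z.im →
    ‖sigmaSeries k z‖ ≤ C / z.im ^ (5 / 2 - k : ℝ) := by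
  refine ⟨6 * ∑' n : ℕ, (sigma1 (n + 1) : ℝ) / ((n : ℝ) + 1) ^ (5 / 2 : ℝ),
    mul_nonneg (by norm_num) (tsum_nonneg fun n => by positivity), fun z hz => ?_⟩
  have := tsum_of_norm_bounded
    (summable_sigma1_div_rpow.hasSum.mul_left (6 / z.im ^ (5 / 2 - k : ℝ)))
    (fun n => norm_sigmaSeries_term_le hk n hz)
  refine this.trans (le_of_eq ?_)
  ring

lemma norm_sigmaSeries_three_term_le (n : ℕ) {z : ℂ} (hz : 0 ≤ z.im) :
    ‖(sigma1 (n + 1) : ℂ) / ((n : ℂ) + 1) ^ 3 *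
      Complex.exp (2 * (Real.pi : ℂ) * Complex.I * ((n : ℂ) + 1) * z)‖
      ≤ (sigma1 (n + 1) : ℝ) / ((n : ℝ) + 1) ^ (5 / 2 : ℝ) := by
  have hn : (1 : ℝ) ≤ (n : ℝ) + 1 := by linarith [(Nat.cast_nonneg n : (0 : ℝ) ≤ n)]
  have hnorm : ‖(n : ℂ) + 1‖ = (n : ℝ) + 1 := by
    rw [← Nat.cast_succ, Complex.norm_natCast, Nat.cast_succ]
  rw [norm_mul, norm_div, norm_pow, hnorm, Complex.norm_natCast, norm_exp_two_pi_mul]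
  have h1 : Real.exp (-(2 * Real.pi * (n + 1) * z.im)) ≤ 1 :=
    Real.exp_le_one_iff.mpr (neg_nonpos.mpr (by positivity))
  refine (mul_le_of_le_one_right (by positivity) h1).trans ?_
  refine div_le_div_of_nonneg_left (by positivity) (by positivity) ?_
  rw [← Real.rpow_natCast]
  exact Real.rpow_le_rpow_of_exponent_le hn (by norm_num)

lemma continuousOn_sigmaSeries_three : ContinuousOn (sigmaSeries 3) {z | 0 ≤ z.im} :=
  continuousOn_tsum (fun n => by fun_prop) summable_sigma1_div_rpow
    fun n _ hz => norm_sigmaSeries_three_term_le n hz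

lemma hasDerivAt_sigmaSeries {k : ℕ} (hk : k ≤ 2) {z : ℂ} (hz : 0 < z.im) :
    HasDerivAt (sigmaSeries (k + 1)) (2 * Real.pi * Complex.I * sigmaSeries k z) z := by
  set U : Set ℂ := {w | z.im / 2 < w.im} with hU
  have hUo : IsOpen U := isOpen_lt continuous_const Complex.continuous_im
  have hzU : z ∈ U := by simp only [hU, Set.mem_ofPred_eq]; linarith
  obtain ⟨u, hu, hb⟩ : ∃ u : ℕ → ℝ, Summable u ∧ ∀ n : ℕ, ∀ w ∈ U,
      ‖(sigma1 (n + 1) : ℂ) / ((n : ℂ) + 1) ^ (k + 1) *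
        Complex.exp (2 * (Real.pi : ℂ) * Complex.I * ((n : ℂ) + 1) * w)‖ ≤ u n := by
    rcases hk.lt_or_eq with hk | rfl
    · refine ⟨_, summable_sigma1_div_rpow.mul_left (6 / (z.im / 2) ^ (5 / 2 - (k + 1 : ℕ) : ℝ)),
        fun n w hw => ?_⟩
      have hw' : z.im / 2 < w.im := hw
      refine (norm_sigmaSeries_term_le (by omega) n (by linarith)).trans ?_
      have hk' : ((k + 1 : ℕ) : ℝ) ≤ 2 := by exact_mod_cast hk
      have : (z.im / 2) ^ (5 / 2 - (k + 1 : ℕ) : ℝ) ≤ w.im ^ (5 / 2 - (k + 1 : ℕ) : ℝ) :=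
        Real.rpow_le_rpow (by linarith) hw'.le (by linarith)
      gcongr
    · refine ⟨_, summable_sigma1_div_rpow, fun n w hw => norm_sigmaSeries_three_term_le n ?_⟩
      have hw' : z.im / 2 < w.im := hw
      linarith
  have hd : ∀ n : ℕ, Differentiable ℂ fun w : ℂ => (sigma1 (n + 1) : ℂ) / ((n : ℂ) + 1) ^ (k + 1) *
        Complex.exp (2 * (Real.pi : ℂ) * Complex.I * ((n : ℂ) + 1) * w) := fun n => by fun_prop
  have hs := Complex.hasSum_deriv_of_summable_norm hu (fun n => (hd n).differentiableOn) hUo hb hzU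
  have hdiff := (Complex.differentiableOn_tsum_of_summable_norm hu
    (fun n => (hd n).differentiableOn) hUo hb).differentiableAt (hUo.mem_nhds hzU)
  refine hdiff.hasDerivAt.congr_deriv ?_
  rw [← hs.tsum_eq, sigmaSeries, ← tsum_mul_left]
  congr 1 with n
  have hn : (n : ℂ) + 1 ≠ 0 := Nat.cast_add_one_ne_zero n
  have h1 := ((hasDerivAt_id z).const_mul (2 * (Real.pi : ℂ) * Complex.I * ((n : ℂ) + 1))).cexp
  have h2 := h1.const_mul ((sigma1 (n + 1) : ℂ) / ((n : ℂ) + 1) ^ (k + 1))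
  simp only [id] at h2
  rw [h2.deriv]
  field_simp
  ring

lemma sigmaSeries_zero_eq_E2 (z : UpperHalfPlane) :
    sigmaSeries 0 z = (1 - EisensteinSeries.E2 z) / 24 := by
  rw [EisensteinSeries.E2_eq_tsum_cexp]
  have := tsum_pnat_eq_tsum_succ (f := fun n : ℕ => ((ArithmeticFunction.sigma 1 n : ℕ) : ℂ) *
    Complex.exp (2 * Real.pi * Complex.I * z) ^ n)
  rw [this, sigmaSeries]
  have h : ∀ n : ℕ, (sigma1 (n + 1) : ℂ) / ((n : ℂ) + 1) ^ 0 *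
      Complex.exp (2 * (Real.pi : ℂ) * Complex.I * ((n : ℂ) + 1) * z)
      = ((ArithmeticFunction.sigma 1 (n + 1) : ℕ) : ℂ) *
        Complex.exp (2 * Real.pi * Complex.I * z) ^ (n + 1) := fun n => by
    rw [← Complex.exp_nat_mul, ArithmeticFunction.sigma_one_apply, sigma1]
    push_cast
    rw [pow_zero, div_one]
    congr 2; ring
  simp_rw [h]
  ring

lemma im_cusp_map (q d : ℝ) (τ : ℂ) :
    (-1 / ((q : ℂ) ^ 2 * τ) - (d : ℂ) / q).im = τ.im / (q ^ 2 * ‖τ‖ ^ 2) := by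
  have h1 : (-1 / ((q : ℂ) ^ 2 * τ) - (d : ℂ) / q)
      = (((q ^ 2)⁻¹ : ℝ) : ℂ) * (-τ⁻¹) + ((-(d / q) : ℝ) : ℂ) := by
    push_cast
    rw [neg_div, one_div, mul_inv]; ring
  rw [h1, Complex.add_im, Complex.ofReal_im, Complex.im_ofReal_mul, Complex.neg_im,
    Complex.inv_im, Complex.normSq_eq_norm_sq]
  rw [add_zero, neg_div, neg_neg, inv_mul_eq_div, div_div, mul_comm (_ ^ 2)]

lemma im_intCast_div_add (p q : ℤ) (τ : ℂ) : ((p : ℂ) / q + τ).im = τ.im := by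
  rw [Complex.add_im, show (p : ℂ) / q = (((p : ℝ) / q : ℝ) : ℂ) by push_cast; rfl,
    Complex.ofReal_im, zero_add]

lemma im_cusp_map_pos {q : ℤ} (hq : 0 < q) (d : ℤ) {τ : ℂ} (hτ : 0 < τ.im) :
    0 < (-1 / ((q : ℂ) ^ 2 * τ) - (d : ℂ) / q).im := by
  have hqr : (0 : ℝ) < q := by exact_mod_cast hq
  have hτ0 : τ ≠ 0 := by rintro rfl; simp at hτ
  have := im_cusp_map q d τ
  push_cast at this
  rw [this]
  have := norm_pos_iff.mpr hτ0
  positivity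

/-- Quasimodularity of `E₂`, for a matrix sending `∞` to `p / q`. -/
lemma sigmaSeries_zero_cusp {p b q d : ℤ} (hq : 0 < q) (hdet : p * d - b * q = 1) {τ : ℂ}
    (hτ : 0 < τ.im) :
    sigmaSeries 0 ((p : ℂ) / q + τ) = 1 / 24 - 1 / (24 * (q : ℂ) ^ 2 * τ) / τ
      + 1 / (4 * Real.pi * Complex.I) / τ
      + sigmaSeries 0 (-1 / ((q : ℂ) ^ 2 * τ) - (d : ℂ) / q) / ((q : ℂ) ^ 2 * τ ^ 2) := by
  have hq0 : (q : ℂ) ≠ 0 := by exact_mod_cast hq.ne'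
  have hτ0 : τ ≠ 0 := by rintro rfl; simp at hτ
  have hw := im_cusp_map_pos hq d hτ
  set w : UpperHalfPlane := ⟨_, hw⟩
  have hwc : (w : ℂ) = -1 / ((q : ℂ) ^ 2 * τ) - (d : ℂ) / q := rfl
  have hz : 0 < ((p : ℂ) / q + τ).im := by rwa [im_intCast_div_add]
  set z : UpperHalfPlane := ⟨_, hz⟩ with hzdef
  let γ : Matrix.SpecialLinearGroup (Fin 2) ℤ :=
    ⟨!![p, b; q, d], by rw [Matrix.det_fin_two_of]; exact hdet⟩
  have hden : (q : ℂ) * w + d = -1 / (q * τ) := by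
    rw [hwc]; field_simp; ring
  have hdet' : (p : ℂ) * d - b * q = 1 := by exact_mod_cast hdet
  have hγ : γ • w = z := by
    apply UpperHalfPlane.ext
    rw [UpperHalfPlane.specialLinearGroup_apply]
    simp only [γ, hzdef]
    simp
    rw [hden, hwc]
    field_simp
    linear_combination (q * τ) * hdet'
  have hE := congrFun (EisensteinSeries.E2_slash_action γ) w
  rw [ModularForm.SL_slash_apply, hγ] at hE
  have hD : UpperHalfPlane.denom (Matrix.SpecialLinearGroup.toGL
      ((Matrix.SpecialLinearGroup.map (Int.castRingHom ℝ)) γ)) w = -1 / (q * τ) := by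
    rw [← hden, ModularGroup.denom_apply]; rfl
  simp only [Pi.sub_apply, Pi.smul_apply, EisensteinSeries.D2, hD, riemannZeta_two,
    smul_eq_mul] at hE
  have hγ10 : γ 1 0 = q := rfl
  rw [hγ10] at hE
  have h0 : sigmaSeries 0 ((p : ℂ) / q + τ) = (1 - EisensteinSeries.E2 z) / 24 :=
    sigmaSeries_zero_eq_E2 z
  have h1 : sigmaSeries 0 (-1 / ((q : ℂ) ^ 2 * τ) - (d : ℂ) / q)
      = (1 - EisensteinSeries.E2 w) / 24 := sigmaSeries_zero_eq_E2 w
  rw [h0, h1]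
  have hpi : (Real.pi : ℂ) ≠ 0 := by exact_mod_cast Real.pi_ne_zero
  have hI := Complex.I_sq
  have hE2 : EisensteinSeries.E2 z = (EisensteinSeries.E2 w
      - 1 / (2 * ((Real.pi : ℂ) ^ 2 / 6)) * (2 * Real.pi * Complex.I * q / (-1 / (q * τ))))
      * (-1 / (q * τ)) ^ 2 := by
    rw [← hE, mul_assoc, ← zpow_natCast, ← zpow_add₀ (by simp [hq0, hτ0])]
    simp
  rw [hE2]
  field_simp
  ring_nf
  simp only [hI]
  ring

lemma convex_cone_im_le (r : ℝ) : Convex ℝ {τ : ℂ | 0 < τ.im ∧ τ.im ≤ r ∧ |τ.re| ≤ τ.im} := by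
  rintro x ⟨hx0, hx1, hx2⟩ y ⟨hy0, hy1, hy2⟩ a b ha hb hab
  refine ⟨convex_halfSpace_im_gt 0 hx0 hy0 ha hb hab, ?_, ?_⟩
  · simp only [Complex.add_im, Complex.real_smul, Complex.im_ofReal_mul]
    calc a * x.im + b * y.im ≤ a * r + b * r := by gcongr
      _ = r := by rw [← add_mul, hab, one_mul]
  · simp only [Complex.add_im, Complex.add_re, Complex.real_smul, Complex.im_ofReal_mul,
      Complex.re_ofReal_mul]
    calc |a * x.re + b * y.re| ≤ a * |x.re| + b * |y.re| := by
          simpa [abs_mul, abs_of_nonneg ha, abs_of_nonneg hb] using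
            abs_add_le (a * x.re) (b * y.re)
      _ ≤ a * x.im + b * y.im := by gcongr

lemma rpow_three_halves_le {x : ℝ} (hx : 0 ≤ x) (hx2 : x ≤ 2) : x ^ (3 / 2 : ℝ) ≤ 2 * x := by
  have h : x ^ (3 / 2 : ℝ) = x * √x := by
    rw [Real.sqrt_eq_rpow, show (3 / 2 : ℝ) = 1 + 1 / 2 by norm_num,
      Real.rpow_add_of_nonneg hx (by norm_num) (by norm_num), Real.rpow_one]
  have hs : √x ≤ 2 := Real.sqrt_le_iff.mpr ⟨by norm_num, by linarith⟩
  rw [h, mul_comm]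
  gcongr

/-- A function whose derivative is bounded on a cone with vertex `0` is affine-Lipschitz there. -/
lemma exists_norm_sub_le_of_deriv_bound_on_cone {f f' : ℂ → ℂ} {L : ℝ} (hL : 0 ≤ L)
    (hf : ∀ τ : ℂ, 0 < τ.im → HasDerivAt f (f' τ) τ)
    (hb : ∀ τ : ℂ, 0 < τ.im → τ.im ≤ 1 → |τ.re| ≤ τ.im → ‖f' τ‖ ≤ L) :
    ∃ B : ℂ, ∀ τ : ℂ, 0 < τ.im → τ.im ≤ 1 → |τ.re| ≤ τ.im → ‖f τ - B‖ ≤ L * ‖τ‖ := by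
  have hlip : ∀ x ∈ {τ : ℂ | 0 < τ.im ∧ τ.im ≤ 1 ∧ |τ.re| ≤ τ.im},
      ∀ y ∈ {τ : ℂ | 0 < τ.im ∧ τ.im ≤ 1 ∧ |τ.re| ≤ τ.im}, ‖f y - f x‖ ≤ L * ‖y - x‖ :=
    fun x hx y hy => Convex.norm_image_sub_le_of_norm_hasDerivWithin_le
      (fun z hz => (hf z hz.1).hasDerivWithinAt) (fun z hz => hb z hz.1 hz.2.1 hz.2.2)
      (convex_cone_im_le 1) hx hy
  let u : ℕ → ℂ := fun n => ((1 / ((n : ℝ) + 1) : ℝ) : ℂ) * Complex.I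
  have hu_norm : ∀ n, ‖u n‖ = 1 / ((n : ℝ) + 1) := fun n => by
    simp only [u, norm_mul, Complex.norm_I, mul_one, Complex.norm_real, Real.norm_eq_abs]
    exact abs_of_pos (by positivity)
  have hu_mem : ∀ n, u n ∈ {τ : ℂ | 0 < τ.im ∧ τ.im ≤ 1 ∧ |τ.re| ≤ τ.im} := fun n => by
    have him : (u n).im = 1 / ((n : ℝ) + 1) := by
      simp only [u, Complex.im_ofReal_mul, Complex.I_im, mul_one]
    have hre : (u n).re = 0 := by
      simp only [u, Complex.re_ofReal_mul, Complex.I_re, mul_zero]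
    have hpos : 0 < 1 / ((n : ℝ) + 1) := by positivity
    refine ⟨by rwa [him], ?_, by rw [him, hre, abs_zero]; exact hpos.le⟩
    rw [him, div_le_one (by positivity)]
    linarith [(Nat.cast_nonneg n : (0 : ℝ) ≤ n)]
  have hlim : Tendsto (fun n : ℕ => 1 / ((n : ℝ) + 1)) atTop (nhds 0) :=
    tendsto_one_div_add_atTop_nhds_zero_nat
  have hu : Tendsto u atTop (nhds 0) :=
    tendsto_zero_iff_norm_tendsto_zero.mpr (by simpa only [hu_norm] using hlim)
  have hcauchy : CauchySeq fun n => f (u n) := by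
    refine cauchySeq_of_le_tendsto_0 (fun N : ℕ => L * (2 * (1 / ((N : ℝ) + 1))))
      (fun n m N hn hm => ?_) (by simpa using (hlim.const_mul 2).const_mul L)
    rw [dist_eq_norm]
    refine (hlip _ (hu_mem m) _ (hu_mem n)).trans (mul_le_mul_of_nonneg_left ?_ hL)
    refine (norm_sub_le _ _).trans ?_
    rw [hu_norm, hu_norm, two_mul]
    gcongr
  obtain ⟨B, hB⟩ := cauchySeq_tendsto_of_complete hcauchy
  refine ⟨B, fun τ h0 h1 h2 => ?_⟩
  refine le_of_tendsto_of_tendsto' ((tendsto_const_nhds.sub hB).norm)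
    (((tendsto_const_nhds (x := τ)).sub hu).norm.const_mul L)
    (fun n => hlip _ (hu_mem n) _ ⟨h0, h1, h2⟩) |>.trans (by rw [sub_zero])

lemma norm_sub_sub_le_of_second_deriv_bound {R R' R'' : ℂ → ℂ} {C : ℝ} (hC : 0 ≤ C)
    (h1 : ∀ τ : ℂ, 0 < τ.im → HasDerivAt R (R' τ) τ)
    (h2 : ∀ τ : ℂ, 0 < τ.im → HasDerivAt R' (R'' τ) τ)
    (hb : ∀ τ : ℂ, 0 < τ.im → ‖R'' τ‖ ≤ C * (‖τ‖ ^ 2 / τ.im) ^ (3 / 2 : ℝ))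
    (hc : ContinuousOn R {z | 0 ≤ z.im}) {h : ℝ} (hh0 : h ≠ 0) (hh : |h| ≤ 1)
    (hlim : Tendsto (fun t : ℝ => (t : ℂ) * R' (h + t * Complex.I)) (nhdsWithin 0 (Set.Ioi 0))
      (nhds 0)) :
    ‖R (h + |h| * Complex.I) - |h| * Complex.I * R' (h + |h| * Complex.I) - R h‖
      ≤ 8 * C * h ^ 2 := by
  set r := |h| with hr
  have hr0 : 0 < r := abs_pos.mpr hh0
  let κ : ℝ → ℂ := fun u => R (h + (u : ℂ) ^ 2 * Complex.I)
    - (u : ℂ) ^ 2 * Complex.I * R' (h + (u : ℂ) ^ 2 * Complex.I)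
  have him : ∀ u : ℝ, ((h : ℂ) + (u : ℂ) ^ 2 * Complex.I).im = u ^ 2 := fun u => by
    rw [← Complex.ofReal_pow, Complex.add_im, Complex.ofReal_im, Complex.im_ofReal_mul,
      Complex.I_im]
    ring
  have hre : ∀ u : ℝ, ((h : ℂ) + (u : ℂ) ^ 2 * Complex.I).re = h := fun u => by
    rw [← Complex.ofReal_pow, Complex.add_re, Complex.ofReal_re, Complex.re_ofReal_mul,
      Complex.I_re]
    ring
  have hderiv : ∀ u ∈ Set.Ioc 0 √r,
      HasDerivAt κ (2 * (u : ℂ) ^ 3 * R'' (h + (u : ℂ) ^ 2 * Complex.I)) u := fun u hu => by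
    have hpos : 0 < ((h : ℂ) + (u : ℂ) ^ 2 * Complex.I).im := by
      rw [him]; exact pow_pos hu.1 2
    have hq : HasDerivAt (fun w : ℂ => w ^ 2 * Complex.I) (2 * (u : ℂ) * Complex.I) (u : ℂ) := by
      simpa using (hasDerivAt_pow 2 (u : ℂ)).mul_const Complex.I
    have hγ := hq.const_add (h : ℂ)
    have hA := (h1 _ hpos).comp (u : ℂ) hγ
    have hB := hq.mul ((h2 _ hpos).comp (u : ℂ) hγ)
    have := (hA.sub hB).comp_ofReal
    refine this.congr_deriv ?_
    simp only [Function.comp]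
    linear_combination (-2 * (u : ℂ) ^ 3 * R'' (h + (u : ℂ) ^ 2 * Complex.I)) * Complex.I_sq
  have hbound : ∀ u ∈ Set.Ioc 0 √r,
      ‖2 * (u : ℂ) ^ 3 * R'' (h + (u : ℂ) ^ 2 * Complex.I)‖ ≤ 8 * C * r ^ 2 := fun u hu => by
    have hu0 : 0 < u := hu.1
    have hpos : 0 < ((h : ℂ) + (u : ℂ) ^ 2 * Complex.I).im := by
      rw [him]; exact pow_pos hu.1 2
    have hur : u ^ 2 ≤ r := by
      calc u ^ 2 ≤ √r ^ 2 := pow_le_pow_left₀ hu0.le hu.2 2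
        _ = r := Real.sq_sqrt hr0.le
    have hn : ‖(h : ℂ) + (u : ℂ) ^ 2 * Complex.I‖ ^ 2 ≤ 2 * r ^ 2 := by
      rw [Complex.sq_norm, Complex.normSq_apply, him, hre]
      nlinarith [sq_abs h, sq_nonneg u]
    have hR := hb _ hpos
    rw [him] at hR
    have hpow : (‖(h : ℂ) + (u : ℂ) ^ 2 * Complex.I‖ ^ 2 / u ^ 2) ^ (3 / 2 : ℝ)
        ≤ 4 * r ^ 2 / u ^ 3 := by
      have hu3 : (u ^ 2) ^ (3 / 2 : ℝ) = u ^ 3 := by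
        rw [← Real.rpow_natCast u 2, ← Real.rpow_mul hu0.le, ← Real.rpow_natCast u 3]
        norm_num
      rw [Real.div_rpow (by positivity) (by positivity), hu3]
      gcongr
      calc (‖(h : ℂ) + (u : ℂ) ^ 2 * Complex.I‖ ^ 2) ^ (3 / 2 : ℝ)
          ≤ (2 * r ^ 2) ^ (3 / 2 : ℝ) := Real.rpow_le_rpow (by positivity) hn (by norm_num)
        _ ≤ 2 * (2 * r ^ 2) := rpow_three_halves_le (by positivity) (by nlinarith)
        _ = 4 * r ^ 2 := by ring
    rw [norm_mul, norm_mul, norm_pow, Complex.norm_real, Real.norm_eq_abs, abs_of_pos hu0,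
      Complex.norm_ofNat]
    calc 2 * u ^ 3 * ‖R'' (h + (u : ℂ) ^ 2 * Complex.I)‖
        ≤ 2 * u ^ 3 * (C * (4 * r ^ 2 / u ^ 3)) := by
          gcongr
          exact hR.trans (by gcongr)
      _ = 8 * C * r ^ 2 := by field_simp; ring
  have hlip : ∀ u ∈ Set.Ioc 0 √r, ‖κ √r - κ u‖ ≤ 8 * C * r ^ 2 := fun u hu => by
    have hle := Convex.norm_image_sub_le_of_norm_hasDerivWithin_le
      (fun v hv => (hderiv v hv).hasDerivWithinAt) hbound (convex_Ioc 0 √r) hu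
      ⟨Real.sqrt_pos.mpr hr0, le_rfl⟩
    refine hle.trans (mul_le_of_le_one_right (by positivity) ?_)
    rw [Real.norm_eq_abs, abs_of_nonneg (by linarith [hu.2])]
    have : √r ≤ 1 := Real.sqrt_le_one.mpr hh
    linarith [hu.1]
  have hsq : Tendsto (fun u : ℝ => u ^ 2) (nhdsWithin 0 (Set.Ioi 0))
      (nhdsWithin 0 (Set.Ioi 0)) := by
    refine tendsto_nhdsWithin_iff.mpr ⟨?_, ?_⟩
    · have : Tendsto (fun u : ℝ => u ^ 2) (nhds 0) (nhds (0 ^ 2)) := (continuous_pow 2).tendsto 0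
      simpa using this.mono_left nhdsWithin_le_nhds
    · filter_upwards [self_mem_nhdsWithin] with u hu using pow_pos (Set.mem_Ioi.mp hu) 2
  have hκ : Tendsto κ (nhdsWithin 0 (Set.Ioi 0)) (nhds (R h)) := by
    have hA : Tendsto (fun u : ℝ => (h : ℂ) + (u : ℂ) ^ 2 * Complex.I) (nhdsWithin 0 (Set.Ioi 0))
        (nhdsWithin (h : ℂ) {z | 0 ≤ z.im}) := by
      refine tendsto_nhdsWithin_iff.mpr ⟨?_, Eventually.of_forall fun u => ?_⟩
      · have : Continuous fun u : ℝ => (h : ℂ) + (u : ℂ) ^ 2 * Complex.I := by fun_prop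
        simpa using (this.tendsto 0).mono_left nhdsWithin_le_nhds
      · simp only [Set.mem_ofPred_eq, him]; positivity
    have hB := (hlim.comp hsq).mul_const Complex.I
    have := ((hc (h : ℂ) (by simp)).tendsto.comp hA).sub hB
    rw [zero_mul, sub_zero] at this
    refine this.congr fun u => ?_
    simp only [κ, Function.comp, Complex.ofReal_pow]
    ring
  have hfin : ‖κ √r - R h‖ ≤ 8 * C * r ^ 2 := by
    refine le_of_tendsto ((tendsto_const_nhds.sub hκ).norm) ?_
    filter_upwards [Ioc_mem_nhdsGT (Real.sqrt_pos.mpr hr0)] with u hu using hlip u hu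
  simp only [κ, ← Complex.ofReal_pow, Real.sq_sqrt hr0.le] at hfin
  rwa [hr, sq_abs, ← hr] at hfin

/-- First order expansion at a boundary point of a function on the upper half plane whose second
derivative is controlled by a power of `‖τ‖ ^ 2 / im τ`. -/
lemma exists_linear_approx_of_second_deriv_bound {R R' R'' : ℂ → ℂ} {C : ℝ} (hC : 0 ≤ C)
    (h1 : ∀ τ : ℂ, 0 < τ.im → HasDerivAt R (R' τ) τ)
    (h2 : ∀ τ : ℂ, 0 < τ.im → HasDerivAt R' (R'' τ) τ)
    (hb : ∀ τ : ℂ, 0 < τ.im → ‖R'' τ‖ ≤ C * (‖τ‖ ^ 2 / τ.im) ^ (3 / 2 : ℝ))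
    (hc : ContinuousOn R {z | 0 ≤ z.im})
    (hlim : ∀ h : ℝ, h ≠ 0 → Tendsto (fun t : ℝ => (t : ℂ) * R' (h + t * Complex.I))
      (nhdsWithin 0 (Set.Ioi 0)) (nhds 0)) :
    ∃ (B : ℂ) (K : ℝ), ∀ h : ℝ, |h| ≤ 1 → ‖R h - R 0 - B * h‖ ≤ K * h ^ 2 := by
  have hb' : ∀ τ : ℂ, 0 < τ.im → τ.im ≤ 1 → |τ.re| ≤ τ.im → ‖R'' τ‖ ≤ 4 * C := by
    intro τ h0 hle hre
    have hx : ‖τ‖ ^ 2 / τ.im ≤ 2 := by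
      rw [div_le_iff₀ h0, Complex.sq_norm, Complex.normSq_apply]
      nlinarith [abs_le.mp hre, sq_abs τ.re, abs_nonneg τ.re]
    have := rpow_three_halves_le (x := ‖τ‖ ^ 2 / τ.im) (by positivity) hx
    nlinarith [hb τ h0]
  obtain ⟨B, hB⟩ := exists_norm_sub_le_of_deriv_bound_on_cone (by positivity) h2 hb'
  refine ⟨B, 32 * C, fun h hh => ?_⟩
  rcases eq_or_ne h 0 with rfl | hh0
  · simp
  have hvert := norm_sub_sub_le_of_second_deriv_bound hC h1 h2 hb hc hh0 hh (hlim h hh0)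
  rw [← sq_abs h] at hvert ⊢
  set r := |h| with hr
  have hr0 : 0 < r := abs_pos.mpr hh0
  set τ : ℂ := h + r * Complex.I with hτ
  have hτim : τ.im = r := by simp [hτ]
  have hτre : τ.re = h := by simp [hτ]
  have hnorm : ∀ z : ℂ, 0 < z.im → z.im ≤ r → |z.re| ≤ z.im → ‖z‖ ≤ 2 * r := fun z h0 h1 h2 => by
    have := Complex.norm_le_abs_re_add_abs_im z
    rw [abs_of_pos h0] at this
    linarith
  have hτn : ‖τ‖ ≤ 2 * r := hnorm τ (by rwa [hτim]) hτim.le (by rw [hτim, hτre])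
  have hslope : ‖R' τ - B‖ ≤ 4 * C * (2 * r) :=
    (hB τ (by rwa [hτim]) (by rwa [hτim]) (by rw [hτim, hτre])).trans (by gcongr)
  have hcone : ∀ ε ∈ Set.Ioc 0 r, ‖(R τ - B * τ) - (R (ε * Complex.I) - B * (ε * Complex.I))‖
      ≤ 4 * C * (2 * r) * ‖τ - ε * Complex.I‖ := fun ε hε => by
    refine Convex.norm_image_sub_le_of_norm_hasDerivWithin_le (f := fun z => R z - B * z)
      (f' := fun z => R' z - B) (fun z hz => ?_) (fun z hz => ?_) (convex_cone_im_le r)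
      ⟨by simpa using hε.1, by simpa using hε.2, by simpa using hε.1.le⟩
      ⟨by rwa [hτim], hτim.le, by rw [hτim, hτre]⟩
    · exact ((h1 z hz.1).sub
        (((hasDerivAt_id z).const_mul B).congr_deriv (mul_one B))).hasDerivWithinAt
    · refine (hB z hz.1 (hz.2.1.trans hh) hz.2.2).trans ?_
      gcongr
      exact hnorm z hz.1 hz.2.1 hz.2.2
  have hI : Tendsto (fun ε : ℝ => (ε : ℂ) * Complex.I) (nhdsWithin 0 (Set.Ioi 0)) (nhds 0) := by
    have : Continuous fun ε : ℝ => (ε : ℂ) * Complex.I := by fun_prop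
    simpa using (this.tendsto 0).mono_left nhdsWithin_le_nhds
  have hRI : Tendsto (fun ε : ℝ => R ((ε : ℂ) * Complex.I)) (nhdsWithin 0 (Set.Ioi 0))
      (nhds (R 0)) := by
    refine (hc 0 (by simp)).tendsto.comp (tendsto_nhdsWithin_iff.mpr ⟨hI, ?_⟩)
    filter_upwards [self_mem_nhdsWithin] with ε hε
    simpa using (le_of_lt hε : (0 : ℝ) ≤ ε)
  have hrad : ‖(R τ - B * τ) - R 0‖ ≤ 4 * C * (2 * r) * ‖τ‖ := by
    have hl := (tendsto_const_nhds (x := R τ - B * τ)).sub (hRI.sub (hI.const_mul B))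
    have hr := ((tendsto_const_nhds (x := τ)).sub hI).norm.const_mul (4 * C * (2 * r))
    simp only [mul_zero, sub_zero] at hl hr
    refine le_of_tendsto_of_tendsto hl.norm hr ?_
    filter_upwards [Ioc_mem_nhdsGT hr0] with ε hε using hcone ε hε
  have key : R h - R 0 - B * h = -(R τ - r * Complex.I * R' τ - R h)
      + ((R τ - B * τ) - R 0) + -(r * Complex.I * (R' τ - B)) := by
    rw [hτ]; ring
  rw [key]
  refine (norm_add₃_le).trans ?_
  rw [norm_neg, norm_neg, norm_mul, norm_mul, Complex.norm_I, mul_one, Complex.norm_real,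
    Real.norm_eq_abs, abs_of_pos hr0]
  have e1 : 4 * C * (2 * r) * ‖τ‖ ≤ 4 * C * (2 * r) * (2 * r) := by gcongr
  have e2 : r * ‖R' τ - B‖ ≤ r * (4 * C * (2 * r)) := by gcongr
  nlinarith

lemma continuousWithinAt_log_of_ne_zero {z : ℂ} (hz0 : z ≠ 0) :
    ContinuousWithinAt Complex.log {z | 0 ≤ z.im} z := by
  by_cases hs : z ∈ Complex.slitPlane
  · exact (continuousAt_clog hs).continuousWithinAt
  · rw [Complex.mem_slitPlane_iff, not_or, not_lt, not_not] at hs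
    refine Complex.continuousWithinAt_log_of_re_neg_of_im_zero (lt_of_le_of_ne hs.1 fun h => ?_) hs.2
    exact hz0 (Complex.ext h hs.2)

lemma norm_log_le_abs_log_add_pi (z : ℂ) : ‖Complex.log z‖ ≤ |Real.log ‖z‖| + Real.pi := by
  have := Complex.norm_le_abs_re_add_abs_im (Complex.log z)
  rw [Complex.log_re, Complex.log_im] at this
  linarith [Complex.abs_arg_le_pi z]

lemma continuousOn_mul_log_upper :
    ContinuousOn (fun z : ℂ => z * Complex.log z) {z | 0 ≤ z.im} := by
  intro z hz
  rcases eq_or_ne z 0 with rfl | hz0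
  · refine ContinuousAt.continuousWithinAt ?_
    rw [ContinuousAt, zero_mul]
    have hlim : Tendsto (fun z : ℂ => |‖z‖ * Real.log ‖z‖| + Real.pi * ‖z‖) (nhds 0) (nhds 0) := by
      have : Continuous fun z : ℂ => |‖z‖ * Real.log ‖z‖| + Real.pi * ‖z‖ :=
        (Real.continuous_mul_log.comp continuous_norm).abs.add (by fun_prop)
      simpa using this.tendsto 0
    refine squeeze_zero_norm (fun z => ?_) hlim
    rw [norm_mul, abs_mul, abs_norm]
    nlinarith [norm_log_le_abs_log_add_pi z, norm_nonneg z]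
  · exact continuousWithinAt_id.mul (continuousWithinAt_log_of_ne_zero hz0)

/-- The part of the expansion of `sigmaSeries 3` at a cusp of denominator `q` coming from the polar
terms of `E₂` there. -/
def cuspPart (q τ : ℂ) : ℂ :=
  (2 * Real.pi * Complex.I) ^ 3 * (τ ^ 3 / 144 + τ * Complex.log τ / (24 * q ^ 2)
    + (τ * (τ * Complex.log τ) / 2 - 3 * τ ^ 2 / 4) / (4 * Real.pi * Complex.I))

/-- The first derivative of `cuspPart q`. -/
def cuspPartDeriv (q τ : ℂ) : ℂ :=
  (2 * Real.pi * Complex.I) ^ 3 * (τ ^ 2 / 48 + (Complex.log τ + 1) / (24 * q ^ 2)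
    + (τ * Complex.log τ - τ) / (4 * Real.pi * Complex.I))

/-- The second derivative of `cuspPart q`. -/
def cuspPartDeriv₂ (q τ : ℂ) : ℂ :=
  (2 * Real.pi * Complex.I) ^ 3 * (τ / 24 + 1 / (24 * q ^ 2 * τ)
    + Complex.log τ / (4 * Real.pi * Complex.I))

lemma hasDerivAt_mul_log {τ : ℂ} (hτ : 0 < τ.im) :
    HasDerivAt (fun z => z * Complex.log z) (Complex.log τ + 1) τ := by
  have hτ0 : τ ≠ 0 := by rintro rfl; simp at hτ
  refine ((hasDerivAt_id τ).mul (Complex.hasDerivAt_log (Or.inr hτ.ne'))).congr_deriv ?_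
  simp [mul_inv_cancel₀ hτ0]

lemma hasDerivAt_cuspPart (q : ℂ) {τ : ℂ} (hτ : 0 < τ.im) :
    HasDerivAt (cuspPart q) (cuspPartDeriv q τ) τ := by
  have hm := hasDerivAt_mul_log hτ
  have := ((((hasDerivAt_pow 3 τ).div_const 144).add (hm.div_const (24 * q ^ 2))).add
    (((((hasDerivAt_id τ).mul hm).div_const 2).sub
      (((hasDerivAt_pow 2 τ).const_mul 3).div_const 4)).div_const
      (4 * Real.pi * Complex.I))).const_mul ((2 * Real.pi * Complex.I) ^ 3)
  refine this.congr_deriv ?_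
  simp only [cuspPartDeriv, id]
  push_cast
  ring

lemma hasDerivAt_cuspPartDeriv (q : ℂ) {τ : ℂ} (hτ : 0 < τ.im) :
    HasDerivAt (cuspPartDeriv q) (cuspPartDeriv₂ q τ) τ := by
  have hl := Complex.hasDerivAt_log (z := τ) (Or.inr hτ.ne')
  have := ((((hasDerivAt_pow 2 τ).div_const 48).add ((hl.add_const 1).div_const (24 * q ^ 2))).add
    (((hasDerivAt_mul_log hτ).sub (hasDerivAt_id τ)).div_const
      (4 * Real.pi * Complex.I))).const_mul ((2 * Real.pi * Complex.I) ^ 3)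
  refine this.congr_deriv ?_
  simp only [cuspPartDeriv₂, div_eq_mul_inv, mul_inv]
  push_cast
  ring

lemma hasDerivAt_cuspPartDeriv₂ (q : ℂ) {τ : ℂ} (hτ : 0 < τ.im) :
    HasDerivAt (cuspPartDeriv₂ q) ((2 * Real.pi * Complex.I) ^ 3 *
      (1 / 24 - 1 / (24 * q ^ 2 * τ) / τ + 1 / (4 * Real.pi * Complex.I) / τ)) τ := by
  have hτ0 : τ ≠ 0 := by rintro rfl; simp at hτ
  have hl := Complex.hasDerivAt_log (z := τ) (Or.inr hτ.ne')
  have hi : HasDerivAt (fun z : ℂ => 1 / (24 * q ^ 2 * z)) (-(1 / (24 * q ^ 2 * τ) / τ)) τ := by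
    have := (hasDerivAt_inv hτ0).const_mul ((24 * q ^ 2)⁻¹)
    refine (this.congr_deriv ?_).congr_of_eventuallyEq (Eventually.of_forall fun z => ?_)
    · simp only [mul_inv, div_eq_mul_inv]; ring
    · simp only [one_div, mul_inv]
  have := ((((hasDerivAt_id τ).div_const 24).add hi).add
    (hl.div_const (4 * Real.pi * Complex.I))).const_mul ((2 * Real.pi * Complex.I) ^ 3)
  refine this.congr_deriv ?_
  simp only [div_eq_mul_inv, mul_inv]
  ring

lemma continuousOn_cuspPart (q : ℂ) : ContinuousOn (cuspPart q) {z | 0 ≤ z.im} := by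
  have hm := continuousOn_mul_log_upper
  unfold cuspPart
  exact continuousOn_const.mul (((by fun_prop : ContinuousOn _ _).add (hm.div_const _)).add
    ((((continuousOn_id.mul hm).div_const _).sub (by fun_prop)).div_const _))

lemma continuousWithinAt_cuspPartDeriv (q : ℂ) {z : ℂ} (hz0 : z ≠ 0) :
    ContinuousWithinAt (cuspPartDeriv q) {z | 0 ≤ z.im} z := by
  have hl := continuousWithinAt_log_of_ne_zero hz0
  unfold cuspPartDeriv
  exact continuousWithinAt_const.mul ((ContinuousWithinAt.add (by fun_prop)
    ((hl.add continuousWithinAt_const).div_const _)).add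
    (((continuousWithinAt_id.mul hl).sub continuousWithinAt_id).div_const _))

/-- The integrated form of `sigmaSeries_zero_cusp`. -/
lemma exists_sigmaSeries_one_cusp {p b q d : ℤ} (hq : 0 < q) (hdet : p * d - b * q = 1) :
    ∃ c : ℂ, ∀ τ : ℂ, 0 < τ.im → (2 * Real.pi * Complex.I) ^ 2 * sigmaSeries 1 ((p : ℂ) / q + τ)
      - cuspPartDeriv₂ q τ - c =
      (2 * Real.pi * Complex.I) ^ 2 * sigmaSeries 1 (-1 / ((q : ℂ) ^ 2 * τ) - (d : ℂ) / q) := by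
  let H : ℂ → ℂ := fun τ => (2 * Real.pi * Complex.I) ^ 2 * sigmaSeries 1 ((p : ℂ) / q + τ)
    - cuspPartDeriv₂ q τ
    - (2 * Real.pi * Complex.I) ^ 2 * sigmaSeries 1 (-1 / ((q : ℂ) ^ 2 * τ) - (d : ℂ) / q)
  have hq0 : (q : ℂ) ≠ 0 := by exact_mod_cast hq.ne'
  have hH : ∀ τ : ℂ, 0 < τ.im → HasDerivAt H 0 τ := fun τ hτ => by
    have hτ0 : τ ≠ 0 := by rintro rfl; simp at hτ
    have h1 : HasDerivAt (fun τ => sigmaSeries 1 ((p : ℂ) / q + τ))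
        (2 * Real.pi * Complex.I * sigmaSeries 0 ((p : ℂ) / q + τ)) τ :=
      (hasDerivAt_sigmaSeries (k := 0) (by norm_num)
        (by rwa [im_intCast_div_add])).comp_const_add _ _
    have hw : HasDerivAt (fun τ : ℂ => -1 / ((q : ℂ) ^ 2 * τ) - (d : ℂ) / q)
        (1 / ((q : ℂ) ^ 2 * τ ^ 2)) τ := by
      have := ((hasDerivAt_inv hτ0).const_mul (-((q : ℂ) ^ 2)⁻¹)).sub_const ((d : ℂ) / q)
      refine (this.congr_deriv ?_).congr_of_eventuallyEq (Eventually.of_forall fun z => ?_)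
      · simp only [one_div, mul_inv]; ring
      · simp only [div_eq_mul_inv, mul_inv]; ring
    have h2 := (hasDerivAt_sigmaSeries (k := 0) (by norm_num) (im_cusp_map_pos hq d hτ)).comp τ hw
    have := ((h1.const_mul ((2 * Real.pi * Complex.I) ^ 2)).sub
      (hasDerivAt_cuspPartDeriv₂ q hτ)).sub (h2.const_mul ((2 * Real.pi * Complex.I) ^ 2))
    refine this.congr_deriv ?_
    rw [sigmaSeries_zero_cusp hq hdet hτ]
    ring
  have hopen : IsOpen {z : ℂ | 0 < z.im} := isOpen_lt continuous_const Complex.continuous_im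
  refine ⟨H Complex.I, fun τ hτ => ?_⟩
  have := hopen.is_const_of_deriv_eq_zero (f := H) (convex_halfSpace_im_gt 0).isPreconnected
    (fun z hz => (hH z hz).differentiableAt.differentiableWithinAt) (fun z hz => (hH z hz).deriv)
    (show τ ∈ {z : ℂ | 0 < z.im} from hτ) (show Complex.I ∈ {z : ℂ | 0 < z.im} by simp)
  rw [← this]
  simp only [H]
  ring

lemma tendsto_mul_sigmaSeries_two (p q : ℤ) (h : ℝ) :
    Tendsto (fun t : ℝ => (t : ℂ) * sigmaSeries 2 ((p : ℂ) / q + (h + t * Complex.I)))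
      (nhdsWithin 0 (Set.Ioi 0)) (nhds 0) := by
  obtain ⟨C, -, hC⟩ := norm_sigmaSeries_le (k := 2) le_rfl
  have hlim : Tendsto (fun t : ℝ => C * √t) (nhdsWithin 0 (Set.Ioi 0)) (nhds 0) := by
    have : Continuous fun t : ℝ => C * √t := by fun_prop
    simpa using (this.tendsto 0).mono_left nhdsWithin_le_nhds
  refine squeeze_zero_norm' ?_ hlim
  filter_upwards [self_mem_nhdsWithin] with t ht
  have ht : 0 < t := ht
  have him : ((p : ℂ) / q + (h + t * Complex.I)).im = t := by rw [im_intCast_div_add]; simp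
  have hb := hC ((p : ℂ) / q + (h + t * Complex.I)) (by rwa [him])
  rw [him, show (5 / 2 - (2 : ℕ) : ℝ) = 1 / 2 by norm_num, ← Real.sqrt_eq_rpow] at hb
  rw [norm_mul, Complex.norm_real, Real.norm_eq_abs, abs_of_pos ht]
  calc t * ‖sigmaSeries 2 ((p : ℂ) / q + (h + t * Complex.I))‖ ≤ t * (C / √t) := by gcongr
    _ = C * √t := by
      have := Real.sqrt_pos.mpr ht
      field_simp
      rw [Real.sq_sqrt ht.le, mul_comm]

/-- Boundary expansion of `sigmaSeries 3` at the rational point `p / q`. -/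
lemma exists_sigmaSeries_three_expansion {p b q d : ℤ} (hq : 0 < q) (hdet : p * d - b * q = 1) :
    ∃ (B : ℂ) (K : ℝ), ∀ h : ℝ, |h| ≤ 1 →
      ‖sigmaSeries 3 ((p : ℂ) / q + h) - sigmaSeries 3 ((p : ℂ) / q) - cuspPart q h - B * h‖
        ≤ K * h ^ 2 := by
  obtain ⟨c, hc⟩ := exists_sigmaSeries_one_cusp hq hdet
  obtain ⟨C, hC0, hC⟩ := norm_sigmaSeries_le (k := 1) (by norm_num)
  rw [show (5 / 2 - (1 : ℕ) : ℝ) = 3 / 2 by norm_num] at hC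
  let R : ℂ → ℂ := fun τ => sigmaSeries 3 ((p : ℂ) / q + τ) - cuspPart q τ - c * τ ^ 2 / 2
  let R' : ℂ → ℂ := fun τ => 2 * Real.pi * Complex.I * sigmaSeries 2 ((p : ℂ) / q + τ)
    - cuspPartDeriv q τ - c * τ
  let R'' : ℂ → ℂ := fun τ =>
    (2 * Real.pi * Complex.I) ^ 2 * sigmaSeries 1 (-1 / ((q : ℂ) ^ 2 * τ) - (d : ℂ) / q)
  have hS : ∀ k ≤ 2, ∀ τ : ℂ, 0 < τ.im →
      HasDerivAt (fun τ => sigmaSeries (k + 1) ((p : ℂ) / q + τ))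
        (2 * Real.pi * Complex.I * sigmaSeries k ((p : ℂ) / q + τ)) τ := fun k hk τ hτ =>
    (hasDerivAt_sigmaSeries hk (by rwa [im_intCast_div_add])).comp_const_add _ _
  have h1 : ∀ τ : ℂ, 0 < τ.im → HasDerivAt R (R' τ) τ := fun τ hτ => by
    have := ((hS 2 le_rfl τ hτ).sub (hasDerivAt_cuspPart q hτ)).sub
      (((hasDerivAt_pow 2 τ).const_mul c).div_const 2)
    refine this.congr_deriv ?_
    simp only [R']
    push_cast
    ring
  have h2 : ∀ τ : ℂ, 0 < τ.im → HasDerivAt R' (R'' τ) τ := fun τ hτ => by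
    have := (((hS 1 (by norm_num) τ hτ).const_mul (2 * Real.pi * Complex.I)).sub
      (hasDerivAt_cuspPartDeriv q hτ)).sub ((hasDerivAt_id τ).const_mul c)
    refine this.congr_deriv ?_
    simp only [R'', ← hc τ hτ]
    ring
  have hb : ∀ τ : ℂ, 0 < τ.im → ‖R'' τ‖ ≤ (‖(2 * Real.pi * Complex.I : ℂ) ^ 2‖ * C *
      ((q : ℝ) ^ 2) ^ (3 / 2 : ℝ)) * (‖τ‖ ^ 2 / τ.im) ^ (3 / 2 : ℝ) := fun τ hτ => by
    have hw := hC _ (im_cusp_map_pos hq d hτ)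
    have him := im_cusp_map q d τ
    push_cast at him
    rw [him] at hw
    simp only [R'', norm_mul]
    rw [mul_assoc, mul_assoc, mul_assoc]
    rw [norm_pow, norm_mul, norm_mul]
    refine mul_le_mul_of_nonneg_left (hw.trans (le_of_eq ?_)) (by positivity)
    rw [← Real.mul_rpow (by positivity) (by positivity), div_eq_mul_inv,
      ← Real.inv_rpow (by positivity), inv_div, mul_div_assoc]
  have hcont : ContinuousOn R {z | 0 ≤ z.im} := by
    refine ContinuousOn.sub (ContinuousOn.sub ?_ (continuousOn_cuspPart q)) (by fun_prop)
    refine continuousOn_sigmaSeries_three.comp (by fun_prop) fun z hz => ?_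
    have : 0 ≤ z.im := hz
    simpa only [Set.mem_ofPred_eq, im_intCast_div_add] using this
  have hlim : ∀ h : ℝ, h ≠ 0 → Tendsto (fun t : ℝ => (t : ℂ) * R' (h + t * Complex.I))
      (nhdsWithin 0 (Set.Ioi 0)) (nhds 0) := fun h hh => by
    have hp : Tendsto (fun t : ℝ => (h : ℂ) + t * Complex.I) (nhdsWithin 0 (Set.Ioi 0))
        (nhdsWithin (h : ℂ) {z | 0 ≤ z.im}) := by
      refine tendsto_nhdsWithin_iff.mpr ⟨?_, ?_⟩
      · have : Continuous fun t : ℝ => (h : ℂ) + t * Complex.I := by fun_prop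
        simpa using (this.tendsto 0).mono_left nhdsWithin_le_nhds
      · filter_upwards [self_mem_nhdsWithin] with t ht
        simpa using (le_of_lt ht : (0 : ℝ) ≤ t)
    have ht : Tendsto (fun t : ℝ => (t : ℂ)) (nhdsWithin 0 (Set.Ioi 0)) (nhds 0) := by
      simpa using (Complex.continuous_ofReal.tendsto 0).mono_left nhdsWithin_le_nhds
    have hE := (continuousWithinAt_cuspPartDeriv q (z := (h : ℂ))
      (by exact_mod_cast hh)).tendsto.comp hp
    have hlin := (hp.mono_right nhdsWithin_le_nhds).const_mul c
    have := (((tendsto_mul_sigmaSeries_two p q h).const_mul (2 * Real.pi * Complex.I)).sub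
      (ht.mul hE)).sub (ht.mul hlin)
    simp only [mul_zero, zero_mul, sub_zero] at this
    refine this.congr fun t => ?_
    simp only [R', Function.comp]
    ring
  obtain ⟨B, K, hK⟩ := exists_linear_approx_of_second_deriv_bound (by positivity) h1 h2 hb hcont hlim
  refine ⟨B, K + ‖c‖ / 2, fun h hh => ?_⟩
  have hRh : sigmaSeries 3 ((p : ℂ) / q + h) - sigmaSeries 3 ((p : ℂ) / q) - cuspPart q h - B * h
      = (R h - R 0 - B * h) + c * (h : ℂ) ^ 2 / 2 := by
    simp only [R, cuspPart]
    simp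
    ring
  rw [hRh]
  refine (norm_add_le _ _).trans ?_
  have hn : ‖c * (h : ℂ) ^ 2 / 2‖ = ‖c‖ / 2 * h ^ 2 := by
    rw [norm_div, norm_mul, norm_pow, Complex.norm_real, Real.norm_eq_abs, sq_abs,
      Complex.norm_ofNat]
    ring
  rw [hn, add_mul]
  gcongr
  exact hK h hh

lemma norm_cuspPart_add_le (q : ℂ) {h : ℝ} (hh : |h| ≤ 1) :
    ‖cuspPart q h + Complex.I * (Real.pi : ℂ) ^ 3 / (3 * q ^ 2) * (h * Complex.log h)‖
      ≤ 8 * Real.pi ^ 3 * (h ^ 2 * (1 + ‖Complex.log h‖)) := by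
  have hI : (2 * Real.pi * Complex.I) ^ 3 = -(8 * Complex.I * (Real.pi : ℂ) ^ 3) := by
    linear_combination 8 * (Real.pi : ℂ) ^ 3 * Complex.I * Complex.I_sq
  have heq : cuspPart q h + Complex.I * (Real.pi : ℂ) ^ 3 / (3 * q ^ 2) * (h * Complex.log h)
      = (2 * Real.pi * Complex.I) ^ 3 * ((h : ℂ) ^ 2 * (h / 144
        + (Complex.log h / 2 - 3 / 4) / (4 * Real.pi * Complex.I))) := by
    rw [cuspPart, hI]
    simp only [div_eq_mul_inv, mul_inv]
    ring
  have h1 : ‖(h : ℂ) / 144 + (Complex.log h / 2 - 3 / 4) / (4 * Real.pi * Complex.I)‖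
      ≤ 1 + ‖Complex.log h‖ := by
    have hd : ‖Complex.log h / 2 - 3 / 4‖ ≤ ‖Complex.log h‖ / 2 + 3 / 4 := by
      refine (norm_sub_le _ _).trans (le_of_eq ?_)
      norm_num
    have hpi : 1 ≤ 4 * Real.pi := by linarith [Real.pi_gt_three]
    have hn : ‖(4 * Real.pi * Complex.I : ℂ)‖ = 4 * Real.pi := by
      simp [abs_of_pos Real.pi_pos]
    have hdiv : ‖Complex.log h / 2 - 3 / 4‖ / (4 * Real.pi) ≤ ‖Complex.log h‖ / 2 + 3 / 4 :=
      (div_le_self (norm_nonneg _) hpi).trans hd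
    refine (norm_add_le _ _).trans ?_
    rw [norm_div, norm_div, hn, Complex.norm_real, Real.norm_eq_abs, Complex.norm_ofNat]
    linarith [norm_nonneg (Complex.log h)]
  have h2 : ‖(2 * Real.pi * Complex.I : ℂ) ^ 3‖ = 8 * Real.pi ^ 3 := by
    simp only [norm_pow, norm_mul, Complex.norm_I, Complex.norm_real, Real.norm_eq_abs,
      abs_of_pos Real.pi_pos, Complex.norm_ofNat]
    ring
  rw [heq, norm_mul, norm_mul, h2, norm_pow, Complex.norm_real, Real.norm_eq_abs, sq_abs]
  gcongr

/-- Expansion of `phi2` at `p / q`, on both sides at once through the complex logarithm. -/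
lemma exists_phi2_expansion (p : ℤ) {q : ℕ} (hq : 0 < q) (hpq : Int.gcd p (q : ℤ) = 1) :
    ∃ (B : ℂ) (M : ℝ), ∀ h : ℝ, h ≠ 0 → |q * h| ≤ Real.exp (-1) →
      ‖phi2 ((p : ℝ) / q + h) - phi2 ((p : ℝ) / q)
        + Complex.I * (Real.pi : ℂ) ^ 3 / (3 * (q : ℂ) ^ 2) * (h * Complex.log h) - B * h‖
        ≤ M * ((q * h) ^ 2 * |Real.log (|q * h|)|) := by
  obtain ⟨d, b, hdb⟩ := Int.isCoprime_iff_gcd_eq_one.mpr hpq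
  obtain ⟨B, K, hK⟩ := exists_sigmaSeries_three_expansion (p := p) (b := -b) (q := q) (d := d)
    (by exact_mod_cast hq) (by linarith)
  have hq1 : (1 : ℝ) ≤ q := by exact_mod_cast hq
  have hlogq : 0 ≤ Real.log q := Real.log_nonneg hq1
  refine ⟨B, |K| + 8 * Real.pi ^ 3 * (2 + Real.log q + Real.pi), fun h hh0 hh => ?_⟩
  have habs : |(q : ℝ) * h| = q * |h| := by rw [abs_mul, Nat.abs_cast]
  have hpos : 0 < |h| := abs_pos.mpr hh0
  have hexp : Real.exp (-1) ≤ 1 := Real.exp_le_one_iff.mpr (by norm_num)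
  have hh1 : |h| ≤ 1 := by nlinarith
  have hsq : h ^ 2 ≤ (q * h) ^ 2 := by
    rw [mul_pow]
    exact le_mul_of_one_le_left (sq_nonneg h) (one_le_pow₀ hq1)
  have hL : 1 ≤ |Real.log (|(q : ℝ) * h|)| := by
    have := (Real.log_le_log (by rw [habs]; positivity) hh).trans_eq (Real.log_exp (-1))
    exact le_abs.mpr (Or.inr (by linarith))
  have hlog : ‖Complex.log h‖ ≤ |Real.log (|(q : ℝ) * h|)| + Real.log q + Real.pi := by
    have h1 := norm_log_le_abs_log_add_pi h
    have h2 : Real.log |h| = Real.log (|(q : ℝ) * h|) - Real.log q := by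
      rw [habs, Real.log_mul (by positivity) hpos.ne']
      ring
    rw [Complex.norm_real, Real.norm_eq_abs, h2] at h1
    have h3 := abs_sub (Real.log (|(q : ℝ) * h|)) (Real.log q)
    rw [abs_of_nonneg hlogq] at h3
    linarith
  set L := |Real.log (|(q : ℝ) * h|)|
  have hphi : phi2 ((p : ℝ) / q + h) - phi2 ((p : ℝ) / q)
      + Complex.I * (Real.pi : ℂ) ^ 3 / (3 * (q : ℂ) ^ 2) * (h * Complex.log h) - B * h
      = (sigmaSeries 3 ((p : ℂ) / (q : ℤ) + h) - sigmaSeries 3 ((p : ℂ) / (q : ℤ))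
          - cuspPart (q : ℤ) h - B * h)
        + (cuspPart q h
          + Complex.I * (Real.pi : ℂ) ^ 3 / (3 * (q : ℂ) ^ 2) * (h * Complex.log h)) := by
    have hS : ∀ x : ℝ, phi2 x = sigmaSeries 3 x := fun x => rfl
    rw [hS, hS]
    push_cast
    ring
  rw [hphi]
  have hsum := add_le_add (hK h hh1) (norm_cuspPart_add_le q hh1)
  refine (norm_add_le _ _).trans (hsum.trans ?_)
  have e1 : K * h ^ 2 ≤ |K| * ((q * h) ^ 2 * L) := by
    refine mul_le_mul (le_abs_self K) ?_ (sq_nonneg h) (abs_nonneg K)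
    exact hsq.trans (le_mul_of_one_le_right (sq_nonneg _) hL)
  have e2 : 1 + ‖Complex.log h‖ ≤ (2 + Real.log q + Real.pi) * L := by
    nlinarith [Real.pi_pos]
  have e3 : h ^ 2 * (1 + ‖Complex.log h‖)
      ≤ (q * h) ^ 2 * ((2 + Real.log q + Real.pi) * L) := by gcongr
  calc K * h ^ 2 + 8 * Real.pi ^ 3 * (h ^ 2 * (1 + ‖Complex.log h‖))
      ≤ |K| * ((q * h) ^ 2 * L)
        + 8 * Real.pi ^ 3 * ((q * h) ^ 2 * ((2 + Real.log q + Real.pi) * L)) := by gcongr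
    _ = _ := by ring

/-- Behaviour of `φ₂` near a rational `p/q` in lowest terms: there is a constant `C̃ ∈ ℂ` with
`φ₂(x) = φ₂(p/q) − (iπ³/(3q³))(qx−p)log(qx−p) + C̃(qx−p) + O((qx−p)²log(qx−p))` as `x → (p/q)⁺`,
and
`φ₂(x) = φ₂(p/q) − (iπ³/(3q³))(qx−p)log|qx−p| + (C̃+π⁴/(3q³))(qx−p) + O((qx−p)²log|qx−p|)`
as `x → (p/q)⁻`. -/
theorem phi2_expansion_at_rat (p : ℤ) (q : ℕ) (hq : 0 < q) (hpq : Int.gcd p (q : ℤ) = 1) :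
    ∃ C : ℂ,
      (fun x : ℝ => phi2 x -
          (phi2 ((p : ℝ) / (q : ℝ))
            - Complex.I * (Real.pi : ℂ) ^ 3 / (3 * (q : ℂ) ^ 3) *
              (((q : ℝ) * x - (p : ℝ) : ℝ) : ℂ) * (Real.log ((q : ℝ) * x - (p : ℝ)) : ℂ)
            + C * (((q : ℝ) * x - (p : ℝ) : ℝ) : ℂ)))
        =O[nhdsWithin ((p : ℝ) / (q : ℝ)) (Set.Ioi ((p : ℝ) / (q : ℝ)))]
        (fun x : ℝ => ((q : ℝ) * x - (p : ℝ)) ^ 2 * Real.log ((q : ℝ) * x - (p : ℝ))) ∧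
      (fun x : ℝ => phi2 x -
          (phi2 ((p : ℝ) / (q : ℝ))
            - Complex.I * (Real.pi : ℂ) ^ 3 / (3 * (q : ℂ) ^ 3) *
              (((q : ℝ) * x - (p : ℝ) : ℝ) : ℂ) * (Real.log |(q : ℝ) * x - (p : ℝ)| : ℂ)
            + (C + (Real.pi : ℂ) ^ 4 / (3 * (q : ℂ) ^ 3)) * (((q : ℝ) * x - (p : ℝ) : ℝ) : ℂ)))
        =O[nhdsWithin ((p : ℝ) / (q : ℝ)) (Set.Iio ((p : ℝ) / (q : ℝ)))]
        (fun x : ℝ => ((q : ℝ) * x - (p : ℝ)) ^ 2 * Real.log |(q : ℝ) * x - (p : ℝ)|) := by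
  obtain ⟨B, M, hM⟩ := exists_phi2_expansion p hq hpq
  have hq0 : (q : ℝ) ≠ 0 := by exact_mod_cast hq.ne'
  have hqc : (q : ℂ) ≠ 0 := by exact_mod_cast hq.ne'
  have hqr : (0 : ℝ) < q := by exact_mod_cast hq
  have hsmall : ∀ᶠ x : ℝ in nhds ((p : ℝ) / q), |(q : ℝ) * x - p| < Real.exp (-1) := by
    have hc : Continuous fun x : ℝ => |(q : ℝ) * x - p| := by fun_prop
    refine hc.continuousAt.eventually_lt_const ?_
    simp only [mul_div_cancel₀ (p : ℝ) hq0, sub_self, abs_zero]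
    exact Real.exp_pos _
  refine ⟨B / q + Complex.I * (Real.pi : ℂ) ^ 3 / (3 * (q : ℂ) ^ 3) * Real.log q,
    IsBigO.of_bound M ?_, IsBigO.of_bound M ?_⟩
  · filter_upwards [nhdsWithin_le_nhds hsmall, self_mem_nhdsWithin] with x hx hxp
    have hh : 0 < x - p / q := sub_pos.mpr hxp
    have hqx : (q : ℝ) * x - p = q * (x - p / q) := by field_simp
    rw [hqx] at hx ⊢
    set h := x - (p : ℝ) / q with hdef
    have hxh : x = p / q + h := by rw [hdef]; ring
    have hb := hM h hh.ne' hx.le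
    rw [abs_of_pos (mul_pos hqr hh)] at hb
    rw [norm_mul, norm_pow, Real.norm_eq_abs, Real.norm_eq_abs, sq_abs, hxh]
    refine (le_of_eq ?_).trans hb
    rw [← Complex.ofReal_log hh.le, Real.log_mul hq0 hh.ne']
    congr 1
    push_cast
    field_simp
    ring
  · filter_upwards [nhdsWithin_le_nhds hsmall, self_mem_nhdsWithin] with x hx hxp
    have hh : x - p / q < 0 := sub_neg.mpr hxp
    have hqx : (q : ℝ) * x - p = q * (x - p / q) := by field_simp
    rw [hqx] at hx ⊢
    set h := x - (p : ℝ) / q with hdef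
    have hxh : x = p / q + h := by rw [hdef]; ring
    have hb := hM h hh.ne hx.le
    rw [norm_mul, norm_pow, Real.norm_eq_abs, Real.norm_eq_abs, sq_abs, hxh]
    refine (le_of_eq ?_).trans hb
    have hlog : Complex.log h = Real.log |h| + Real.pi * Complex.I := by
      rw [Complex.log, Complex.arg_ofReal_of_neg hh, Complex.norm_real, Real.norm_eq_abs]
    rw [hlog, abs_mul, abs_of_pos hqr, Real.log_mul hq0 (abs_pos.mpr hh.ne).ne']
    congr 1
    push_cast
    field_simp
    ring_nf
    simp only [Complex.I_sq]
    ring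

end
end
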